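/- arXiv:2509.01781 — 17 statements merged into one kernel-verified Lean document; each statement's English description precedes it below -/
import Mathlib

section
/- For relatively prime positive integers a and b, exactly one of the two equations a·x + b·y = (a−1)(b−1)/2 and 1 + a·x + b·y = (a−1)(b−1)/2 has a solution in nonnegative integers (x, y); moreover, for the equation that is solvable, the nonnegative integer solution (x, y) is unique. -/
/-- Below `a * b`, a representation as `a * x + b * y` with natural `x`, `y` is unique. -/
theorem Nat.Coprime.eq_and_eq_of_mul_add_mul_eq {a b x y x' y' : ℕ} (hab : Nat.Coprime a b)
    (hlt : a * x + b * y < a * b) (h : a * x + b * y = a * x' + b * y') : x = x' ∧ y = y' := by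
  have ha : 0 < a := Nat.pos_of_ne_zero (by rintro rfl; simp at hlt)
  have hb : 0 < b := Nat.pos_of_ne_zero (by rintro rfl; simp at hlt)
  have hx : x < b := by nlinarith
  have hx' : x' < b := by nlinarith
  have hmod : a * x ≡ a * x' [MOD b] := by
    simpa [Nat.ModEq] using congrArg (· % b) h
  have hxx : x = x' :=
    (Nat.ModEq.cancel_left_of_coprime hab.symm hmod).eq_of_lt_of_lt hx hx'
  subst hxx
  exact ⟨rfl, Nat.eq_of_mul_eq_mul_left hb (by omega)⟩

/-- Every integer is `a * u + b * v` with `0 ≤ u < b`. -/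
theorem Nat.Coprime.exists_int_mul_add_mul_eq {a b : ℕ} (hab : Nat.Coprime a b) (hb : 0 < b)
    (n : ℤ) : ∃ u v : ℤ, 0 ≤ u ∧ u < b ∧ a * u + b * v = n := by
  obtain ⟨p, q, hpq⟩ := Nat.isCoprime_iff_coprime.mpr hab
  have hb' : (0 : ℤ) < b := by exact_mod_cast hb
  refine ⟨n * p % b, n * q + a * (n * p / b),
    Int.emod_nonneg _ hb'.ne', Int.emod_lt_of_pos _ hb', ?_⟩
  linear_combination n * hpq + a * Int.emod_add_mul_ediv (n * p) b

theorem Nat.Coprime.even_sub_one_mul_sub_one {a b : ℕ} (hab : Nat.Coprime a b) (ha : 0 < a)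
    (hb : 0 < b) : Even ((a - 1) * (b - 1)) := by
  rw [Nat.even_mul]
  by_contra! h
  simp only [Nat.not_even_iff_odd, Nat.odd_iff] at h
  exact Nat.not_coprime_of_dvd_of_dvd one_lt_two (by omega) (by omega) hab

theorem stmt_0 (a b : ℕ) (ha : 0 < a) (hb : 0 < b) (hab : Nat.Coprime a b) :
    Xor' (∃ x y : ℕ, a * x + b * y = (a - 1) * (b - 1) / 2)
         (∃ x y : ℕ, 1 + a * x + b * y = (a - 1) * (b - 1) / 2) ∧
    (∀ x y x' y' : ℕ, a * x + b * y = (a - 1) * (b - 1) / 2 →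
        a * x' + b * y' = (a - 1) * (b - 1) / 2 → x = x' ∧ y = y') ∧
    (∀ x y x' y' : ℕ, 1 + a * x + b * y = (a - 1) * (b - 1) / 2 →
        1 + a * x' + b * y' = (a - 1) * (b - 1) / 2 → x = x' ∧ y = y') := by
  have hN := Nat.two_mul_div_two_of_even (hab.even_sub_one_mul_sub_one ha hb)
  generalize (a - 1) * (b - 1) / 2 = N at hN ⊢
  have hF : 2 * N + a + b = a * b + 1 := by
    obtain ⟨c, rfl⟩ := Nat.exists_eq_add_of_le' ha
    obtain ⟨d, rfl⟩ := Nat.exists_eq_add_of_le' hb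
    simp only [Nat.add_sub_cancel] at hN
    rw [hN]
    ring
  have hlt : N < a * b := by
    have := Nat.mul_pos ha hb
    omega
  refine ⟨(xor_iff_or_and_not_and _ _).mpr ⟨?_, ?_⟩, ?_, ?_⟩
  · obtain ⟨u, v, hu, hub, huv⟩ := hab.exists_int_mul_add_mul_eq hb N
    rcases le_or_gt 0 v with hv | hv
    · lift u to ℕ using hu
      lift v to ℕ using hv
      exact Or.inl ⟨u, v, by exact_mod_cast huv⟩
    · right
      obtain ⟨x, hx⟩ := Int.eq_ofNat_of_zero_le (show 0 ≤ b - 1 - u by omega)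
      obtain ⟨y, hy⟩ := Int.eq_ofNat_of_zero_le (show 0 ≤ -1 - v by omega)
      refine ⟨x, y, ?_⟩
      zify at hF ⊢
      rw [← hx, ← hy]
      linear_combination -huv - hF
  · rintro ⟨⟨x, y, h⟩, x', y', h'⟩
    refine hab.mul_add_mul_ne_mul (Nat.succ_ne_zero (x + x')) (Nat.succ_ne_zero (y + y')) ?_
    simp only [Nat.succ_eq_add_one]
    linarith
  · intro x y x' y' h h'
    exact hab.eq_and_eq_of_mul_add_mul_eq (by omega) (by omega)
  · intro x y x' y' h h'
    exact hab.eq_and_eq_of_mul_add_mul_eq (by omega) (by omega)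
end

section
/- For every integer k ≥ 1, the following six identities hold: (1/2)(F_{6k−1}−1)F_{6k} + (1/2)(F_{6k−1}−1)F_{6k+1} = (F_{6k}−1)(F_{6k+1}−1)/2; (1/2)(F_{6k+1}−1)F_{6k+1} + (1/2)(F_{6k−1}−1)F_{6k+2} = (F_{6k+1}−1)(F_{6k+2}−1)/2; (1/2)(F_{6k+1}−1)F_{6k+2} + (1/2)(F_{6k+1}−1)F_{6k+3} = (F_{6k+2}−1)(F_{6k+3}−1)/2; 1 + (1/2)(F_{6k+2}−1)F_{6k+3} + (1/2)(F_{6k+2}−1)F_{6k+4} = (F_{6k+3}−1)(F_{6k+4}−1)/2; 1 + (1/2)(F_{6k+4}−1)F_{6k+4} + (1/2)(F_{6k+2}−1)F_{6k+5} = (F_{6k+4}−1)(F_{6k+5}−1)/2; 1 + (1/2)(F_{6k+4}−1)F_{6k+5} + (1/2)(F_{6k+4}−1)F_{6k+6} = (F_{6k+5}−1)(F_{6k+6}−1)/2. In each identity all the displayed halves are nonnegative integers (F_m is odd whenever 3 does not divide m). -/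
/-- Parity and Cassini's identity for the pair `(F_{6j+5}, F_{6j+6})`, with
`F_{6j+5} = 2x + 1` and `F_{6j+6} = 2y + 2`. -/
theorem exists_fib_parity_and_cassini (j : ℕ) :
    ∃ x y : ℕ, Nat.fib (6 * j + 5) = 2 * x + 1 ∧ Nat.fib (6 * j + 6) = 2 * y + 2 ∧
      (2 * x + 1) ^ 2 + (2 * x + 1) * (2 * y + 2) = (2 * y + 2) ^ 2 + 1 := by
  induction j with
  | zero => exact ⟨2, 3, by decide, by decide, by norm_num⟩
  | succ j ih =>
    obtain ⟨x, y, hx, hy, h⟩ := ih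
    have fib_shift (n : ℕ) : Nat.fib (n + 6) = 5 * Nat.fib n + 8 * Nat.fib (n + 1) := by
      simp only [Nat.fib_add_two]
      ring
    have hnext : Nat.fib (6 * j + 7) = 2 * x + 2 * y + 3 := by
      rw [Nat.fib_add_two, hx, hy]
      ring
    refine ⟨5 * x + 8 * y + 10, 8 * x + 13 * y + 16, ?_, ?_, by linarith⟩
    · rw [show 6 * (j + 1) + 5 = 6 * j + 5 + 6 by ring, fib_shift, hx, hy]
      ring
    · rw [show 6 * (j + 1) + 6 = 6 * j + 6 + 6 by ring, fib_shift, hy, hnext]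
      ring

theorem stmt_1 (k : ℕ) (hk : 1 ≤ k) :
    2 ∣ (Nat.fib (6*k-1) - 1) ∧ 2 ∣ (Nat.fib (6*k+1) - 1) ∧
    2 ∣ (Nat.fib (6*k+2) - 1) ∧ 2 ∣ (Nat.fib (6*k+4) - 1) ∧
    (Nat.fib (6*k-1) - 1) / 2 * Nat.fib (6*k) + (Nat.fib (6*k-1) - 1) / 2 * Nat.fib (6*k+1)
      = (Nat.fib (6*k) - 1) * (Nat.fib (6*k+1) - 1) / 2 ∧
    (Nat.fib (6*k+1) - 1) / 2 * Nat.fib (6*k+1) + (Nat.fib (6*k-1) - 1) / 2 * Nat.fib (6*k+2)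
      = (Nat.fib (6*k+1) - 1) * (Nat.fib (6*k+2) - 1) / 2 ∧
    (Nat.fib (6*k+1) - 1) / 2 * Nat.fib (6*k+2) + (Nat.fib (6*k+1) - 1) / 2 * Nat.fib (6*k+3)
      = (Nat.fib (6*k+2) - 1) * (Nat.fib (6*k+3) - 1) / 2 ∧
    1 + (Nat.fib (6*k+2) - 1) / 2 * Nat.fib (6*k+3) + (Nat.fib (6*k+2) - 1) / 2 * Nat.fib (6*k+4)
      = (Nat.fib (6*k+3) - 1) * (Nat.fib (6*k+4) - 1) / 2 ∧
    1 + (Nat.fib (6*k+4) - 1) / 2 * Nat.fib (6*k+4) + (Nat.fib (6*k+2) - 1) / 2 * Nat.fib (6*k+5)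
      = (Nat.fib (6*k+4) - 1) * (Nat.fib (6*k+5) - 1) / 2 ∧
    1 + (Nat.fib (6*k+4) - 1) / 2 * Nat.fib (6*k+5) + (Nat.fib (6*k+4) - 1) / 2 * Nat.fib (6*k+6)
      = (Nat.fib (6*k+5) - 1) * (Nat.fib (6*k+6) - 1) / 2 := by
  obtain ⟨j, rfl⟩ := Nat.exists_eq_add_of_le' hk
  obtain ⟨x, y, h5, h6, h⟩ := exists_fib_parity_and_cassini j
  have h7 : Nat.fib (6 * j + 7) = 2 * (x + y + 1) + 1 := by
    rw [Nat.fib_add_two, h5, h6]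
    ring
  have h8 : Nat.fib (6 * j + 8) = 2 * (x + 2 * y + 2) + 1 := by
    rw [Nat.fib_add_two, h6, h7]
    ring
  have h9 : Nat.fib (6 * j + 9) = 2 * (2 * x + 3 * y + 3) + 2 := by
    rw [Nat.fib_add_two, h7, h8]
    ring
  have h10 : Nat.fib (6 * j + 10) = 2 * (3 * x + 5 * y + 6) + 1 := by
    rw [Nat.fib_add_two, h8, h9]
    ring
  have h11 : Nat.fib (6 * j + 11) = 2 * (5 * x + 8 * y + 10) + 1 := by
    rw [Nat.fib_add_two, h9, h10]
    ring
  have h12 : Nat.fib (6 * j + 12) = 2 * (8 * x + 13 * y + 16) + 2 := by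
    rw [Nat.fib_add_two, h10, h11]
    ring
  have odd_pred (a : ℕ) : 2 * a + 1 - 1 = 2 * a := rfl
  have even_pred (a : ℕ) : 2 * a + 2 - 1 = 2 * a + 1 := rfl
  have half (a : ℕ) : 2 * a / 2 = a := by omega
  rw [show 6 * (j + 1) - 1 = 6 * j + 5 by omega, show 6 * (j + 1) = 6 * j + 6 by ring]
  simp only [add_assoc (6 * j), Nat.reduceAdd, h5, h6, h7, h8, h9, h10, h11, h12,
    odd_pred, even_pred, half]
  refine ⟨dvd_mul_right _ _, dvd_mul_right _ _, dvd_mul_right _ _, dvd_mul_right _ _,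
    ?_, ?_, ?_, ?_, ?_, ?_⟩ <;>
  · refine (Nat.div_eq_of_eq_mul_right two_pos ?_).symm
    linarith
end

section
/- For every integer k ≥ 1, the following six identities hold: (1/2)(F_{6k+2}−1)F_{6k+1} + (1/2)(F_{6k−1}−1)F_{6k+3} = (F_{6k+1}−1)(F_{6k+3}−1)/2; (1/2)(F_{6k+2}−1)F_{6k+2} + (1/2)(F_{6k+1}−1)F_{6k+4} = (F_{6k+2}−1)(F_{6k+4}−1)/2; (1/2)(F_{6k+4}−1)F_{6k+3} + (1/2)(F_{6k+1}−1)F_{6k+5} = (F_{6k+3}−1)(F_{6k+5}−1)/2; 1 + (1/2)(F_{6k+5}−1)F_{6k+4} + (1/2)(F_{6k+2}−1)F_{6k+6} = (F_{6k+4}−1)(F_{6k+6}−1)/2; 1 + (1/2)(F_{6k+5}−1)F_{6k+5} + (1/2)(F_{6k+4}−1)F_{6k+7} = (F_{6k+5}−1)(F_{6k+7}−1)/2; 1 + (1/2)(F_{6k+1}−1)F_{6k} + (1/2)(F_{6k−2}−1)F_{6k+2} = (F_{6k}−1)(F_{6k+2}−1)/2. In each identity all the displayed halves are nonnegative integers.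 -/
/-- The Fibonacci numbers at indices `6 * j + 4` and `6 * j + 5` are odd; the last equation is
Cassini's identity in terms of their halves. -/
theorem exists_fib_six_mul_add_four_eq (j : ℕ) :
    ∃ x y : ℕ, Nat.fib (6 * j + 4) = 2 * x + 1 ∧ Nat.fib (6 * j + 5) = 2 * y + 1 ∧
      2 * y ^ 2 + y = 2 * x * y + 2 * x ^ 2 + 3 * x + 1 := by
  induction j with
  | zero => exact ⟨1, 2, by decide, by decide, by norm_num⟩
  | succ j ih =>
    obtain ⟨x, y, hx, hy, h⟩ := ih
    have h6 := Nat.fib_add_two (n := 6 * j + 4)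
    have h7 := Nat.fib_add_two (n := 6 * j + 5)
    have h8 := Nat.fib_add_two (n := 6 * j + 6)
    have h9 := Nat.fib_add_two (n := 6 * j + 7)
    have h10 := Nat.fib_add_two (n := 6 * j + 8)
    have h11 := Nat.fib_add_two (n := 6 * j + 9)
    simp only [add_assoc, Nat.reduceAdd] at h6 h7 h8 h9 h10 h11
    refine ⟨5 * x + 8 * y + 6, 8 * x + 13 * y + 10, ?_, ?_, by nlinarith [h]⟩
    · rw [show 6 * (j + 1) + 4 = 6 * j + 10 by ring]
      lia
    · rw [show 6 * (j + 1) + 5 = 6 * j + 11 by ring]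
      lia

theorem stmt_2 (k : ℕ) (hk : 1 ≤ k) :
    2 ∣ (Nat.fib (6*k-2) - 1) ∧ 2 ∣ (Nat.fib (6*k-1) - 1) ∧
    2 ∣ (Nat.fib (6*k+1) - 1) ∧ 2 ∣ (Nat.fib (6*k+2) - 1) ∧
    2 ∣ (Nat.fib (6*k+4) - 1) ∧ 2 ∣ (Nat.fib (6*k+5) - 1) ∧
    (Nat.fib (6*k+2) - 1) / 2 * Nat.fib (6*k+1) + (Nat.fib (6*k-1) - 1) / 2 * Nat.fib (6*k+3)
      = (Nat.fib (6*k+1) - 1) * (Nat.fib (6*k+3) - 1) / 2 ∧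
    (Nat.fib (6*k+2) - 1) / 2 * Nat.fib (6*k+2) + (Nat.fib (6*k+1) - 1) / 2 * Nat.fib (6*k+4)
      = (Nat.fib (6*k+2) - 1) * (Nat.fib (6*k+4) - 1) / 2 ∧
    (Nat.fib (6*k+4) - 1) / 2 * Nat.fib (6*k+3) + (Nat.fib (6*k+1) - 1) / 2 * Nat.fib (6*k+5)
      = (Nat.fib (6*k+3) - 1) * (Nat.fib (6*k+5) - 1) / 2 ∧
    1 + (Nat.fib (6*k+5) - 1) / 2 * Nat.fib (6*k+4) + (Nat.fib (6*k+2) - 1) / 2 * Nat.fib (6*k+6)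
      = (Nat.fib (6*k+4) - 1) * (Nat.fib (6*k+6) - 1) / 2 ∧
    1 + (Nat.fib (6*k+5) - 1) / 2 * Nat.fib (6*k+5) + (Nat.fib (6*k+4) - 1) / 2 * Nat.fib (6*k+7)
      = (Nat.fib (6*k+5) - 1) * (Nat.fib (6*k+7) - 1) / 2 ∧
    1 + (Nat.fib (6*k+1) - 1) / 2 * Nat.fib (6*k) + (Nat.fib (6*k-2) - 1) / 2 * Nat.fib (6*k+2)
      = (Nat.fib (6*k) - 1) * (Nat.fib (6*k+2) - 1) / 2 := by
  obtain ⟨j, rfl⟩ : ∃ j, k = j + 1 := ⟨k - 1, by lia⟩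
  obtain ⟨x, y, f4, f5, h⟩ := exists_fib_six_mul_add_four_eq j
  have f6 : Nat.fib (6 * j + 6) = 2 * x + 2 * y + 2 := by
    rw [Nat.fib_add_two (n := 6 * j + 4)]
    simp only [add_assoc, Nat.reduceAdd, f4, f5]
    ring
  have f7 : Nat.fib (6 * j + 7) = 2 * x + 4 * y + 3 := by
    rw [Nat.fib_add_two (n := 6 * j + 5)]
    simp only [add_assoc, Nat.reduceAdd, f5, f6]
    ring
  have f8 : Nat.fib (6 * j + 8) = 4 * x + 6 * y + 5 := by
    rw [Nat.fib_add_two (n := 6 * j + 6)]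
    simp only [add_assoc, Nat.reduceAdd, f6, f7]
    ring
  have f9 : Nat.fib (6 * j + 9) = 6 * x + 10 * y + 8 := by
    rw [Nat.fib_add_two (n := 6 * j + 7)]
    simp only [add_assoc, Nat.reduceAdd, f7, f8]
    ring
  have f10 : Nat.fib (6 * j + 10) = 10 * x + 16 * y + 13 := by
    rw [Nat.fib_add_two (n := 6 * j + 8)]
    simp only [add_assoc, Nat.reduceAdd, f8, f9]
    ring
  have f11 : Nat.fib (6 * j + 11) = 16 * x + 26 * y + 21 := by
    rw [Nat.fib_add_two (n := 6 * j + 9)]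
    simp only [add_assoc, Nat.reduceAdd, f9, f10]
    ring
  have f12 : Nat.fib (6 * j + 12) = 26 * x + 42 * y + 34 := by
    rw [Nat.fib_add_two (n := 6 * j + 10)]
    simp only [add_assoc, Nat.reduceAdd, f10, f11]
    ring
  have f13 : Nat.fib (6 * j + 13) = 42 * x + 68 * y + 55 := by
    rw [Nat.fib_add_two (n := 6 * j + 11)]
    simp only [add_assoc, Nat.reduceAdd, f11, f12]
    ring
  have div_two {a b : ℕ} (hab : a = 2 * b + 1) : (a - 1) / 2 = b := by lia
  have dvd {a b : ℕ} (hab : a = 2 * b + 1) : 2 ∣ a - 1 := ⟨b, by lia⟩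
  have i4 : 6 * (j + 1) - 2 = 6 * j + 4 := by lia
  have i5 : 6 * (j + 1) - 1 = 6 * j + 5 := by lia
  have i6 : 6 * (j + 1) = 6 * j + 6 := by lia
  simp only [i4, i5]
  simp only [i6, add_assoc, Nat.reduceAdd]
  have g7 : Nat.fib (6 * j + 7) = 2 * (x + 2 * y + 1) + 1 := by lia
  have g8 : Nat.fib (6 * j + 8) = 2 * (2 * x + 3 * y + 2) + 1 := by lia
  have g10 : Nat.fib (6 * j + 10) = 2 * (5 * x + 8 * y + 6) + 1 := by lia
  have g11 : Nat.fib (6 * j + 11) = 2 * (8 * x + 13 * y + 10) + 1 := by lia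
  refine ⟨dvd f4, dvd f5, dvd g7, dvd g8, dvd g10, dvd g11, ?_, ?_, ?_, ?_, ?_, ?_⟩
  · rw [div_two g8, div_two f5, f7, f9]
    refine Nat.eq_div_of_mul_eq_right two_ne_zero ?_
    simp only [Nat.add_one_sub_one]
    linear_combination 2 * h
  · rw [div_two g8, div_two g7, f8, f10]
    refine Nat.eq_div_of_mul_eq_right two_ne_zero ?_
    simp only [Nat.add_one_sub_one]
    linear_combination 2 * h
  · rw [div_two g10, div_two g7, f9, f11]
    refine Nat.eq_div_of_mul_eq_right two_ne_zero ?_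
    simp only [Nat.add_one_sub_one]
    linear_combination 2 * h
  · rw [div_two g11, div_two g8, f10, f12]
    refine Nat.eq_div_of_mul_eq_right two_ne_zero ?_
    simp only [Nat.add_one_sub_one]
    linear_combination 2 * h.symm
  · rw [div_two g11, div_two g10, f11, f13]
    refine Nat.eq_div_of_mul_eq_right two_ne_zero ?_
    simp only [Nat.add_one_sub_one]
    linear_combination 2 * h.symm
  · rw [div_two g7, div_two f4, f6, f8]
    refine Nat.eq_div_of_mul_eq_right two_ne_zero ?_
    simp only [Nat.add_one_sub_one]
    linear_combination 2 * h.symm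
end

section
/- Let n ≥ 2 be an integer with n ≡ 0, 2, 3 or 5 (mod 6). Then F_{n−1} is odd, the quantities x = F_n² − (F_{n−1}²+1)/2 and y = (F_{n−1}²−1)/2 are nonnegative integers, and F_n²·x + F_{n+1}²·y = (F_n²−1)(F_{n+1}²−1)/2. In particular (x, y) is the unique nonnegative integer solution of the equation F_n²·x + F_{n+1}²·y = (F_n²−1)(F_{n+1}²−1)/2. -/
/-- The Fibonacci numbers, regarded as integers. -/
def F (m : ℕ) : ℤ := Nat.fib m

theorem sq_fib_add_two_mul_fib_sub_sq (m : ℕ) :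
    ((F m + F (m + 1)) * F m - F (m + 1) ^ 2) ^ 2 = 1 := by
  induction m with
  | zero => simp [F]
  | succ m ih =>
    have h : F (m + 2) = F m + F (m + 1) := by simp [F, Nat.fib_add_two]
    rw [h, ← ih]
    ring

theorem odd_F_of_not_three_dvd {m : ℕ} (hm : ¬ 3 ∣ m) : Odd (F m) := by
  have hcop : Nat.gcd 3 m = 1 := (Nat.Prime.coprime_iff_not_dvd Nat.prime_three).2 hm
  have h := Nat.fib_gcd 3 m
  rw [hcop] at h
  have h2 : Nat.Coprime 2 (Nat.fib m) := by simpa [Nat.fib_add_two, Nat.Coprime] using h.symm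
  exact (Int.odd_coe_nat _).2 (Nat.coprime_two_left.1 h2)

/-- A solution of `p * x + q * y = N` with `0 ≤ x < q` and `0 ≤ y < p`, where `p` and `q` are
coprime, is the only nonnegative one. -/
theorem IsCoprime.eq_of_linear_combination_eq {p q x₀ y₀ x y : ℤ} (hpq : IsCoprime p q)
    (hp : 0 < p) (hq : 0 < q) (hx₀ : x₀ < q) (hy₀ : y₀ < p) (hx : 0 ≤ x) (hy : 0 ≤ y)
    (h : p * x + q * y = p * x₀ + q * y₀) : x = x₀ ∧ y = y₀ := by
  obtain ⟨k, hk⟩ : q ∣ x - x₀ :=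
    hpq.symm.dvd_of_dvd_mul_left ⟨y₀ - y, by linear_combination h⟩
  have hky : y₀ - y = p * k :=
    mul_left_cancel₀ hq.ne' (by linear_combination p * hk - h)
  have hk1 : k < 1 := by nlinarith
  have hk0 : -1 < k := by nlinarith
  obtain rfl : k = 0 := by omega
  constructor <;> linarith

theorem stmt_3 (n : ℕ) (hn : 2 ≤ n)
    (h6 : n % 6 = 0 ∨ n % 6 = 2 ∨ n % 6 = 3 ∨ n % 6 = 5) :
    Odd (F (n-1)) ∧
    2 ∣ (F (n-1) ^ 2 + 1) ∧ 2 ∣ (F (n-1) ^ 2 - 1) ∧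
    0 ≤ F n ^ 2 - (F (n-1) ^ 2 + 1) / 2 ∧
    0 ≤ (F (n-1) ^ 2 - 1) / 2 ∧
    F n ^ 2 * (F n ^ 2 - (F (n-1) ^ 2 + 1) / 2)
      + F (n+1) ^ 2 * ((F (n-1) ^ 2 - 1) / 2)
      = (F n ^ 2 - 1) * (F (n+1) ^ 2 - 1) / 2 ∧
    (∀ x y : ℤ, 0 ≤ x → 0 ≤ y →
      F n ^ 2 * x + F (n+1) ^ 2 * y = (F n ^ 2 - 1) * (F (n+1) ^ 2 - 1) / 2 →
      x = F n ^ 2 - (F (n-1) ^ 2 + 1) / 2 ∧ y = (F (n-1) ^ 2 - 1) / 2) := by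
  obtain ⟨m, rfl⟩ : ∃ m, n = m + 1 := ⟨n - 1, by omega⟩
  have hodd : Odd (F m) := odd_F_of_not_three_dvd (by omega)
  have hcas := sq_fib_add_two_mul_fib_sub_sq m
  have hrec : F (m + 2) = F m + F (m + 1) := by simp [F, Nat.fib_add_two]
  have hc : 1 ≤ F m := by
    have : 0 < Nat.fib m := Nat.fib_pos.2 (by omega)
    unfold F
    omega
  have hca : F m ≤ F (m + 1) := by
    unfold F
    exact_mod_cast Nat.fib_le_fib_succ
  have hcop : IsCoprime (F (m + 1)) (F (m + 2)) :=
    Nat.isCoprime_iff_coprime.2 (Nat.fib_coprime_fib_succ (m + 1))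
  simp only [Nat.add_sub_cancel, add_assoc, Nat.reduceAdd]
  obtain ⟨k, hk⟩ : 2 ∣ F m ^ 2 - 1 := (hodd.pow.sub_odd odd_one).two_dvd
  have hk' : F m ^ 2 + 1 = 2 * (k + 1) := by linear_combination hk
  have hdiv : (F m ^ 2 - 1) / 2 = k := by omega
  have hdiv' : (F m ^ 2 + 1) / 2 = k + 1 := by omega
  have hk0 : 0 ≤ k := by nlinarith
  have hka : k + 1 ≤ F (m + 1) ^ 2 := by nlinarith
  have hsol : F (m + 1) ^ 2 * (F (m + 1) ^ 2 - (k + 1)) + F (m + 2) ^ 2 * k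
      = (F (m + 1) ^ 2 - 1) * (F (m + 2) ^ 2 - 1) / 2 := by
    refine (Int.ediv_eq_of_eq_mul_right two_ne_zero ?_).symm
    rw [hrec]
    linear_combination (F (m + 1) ^ 2 - (F m + F (m + 1)) ^ 2) * (-hk) - hcas
  rw [hdiv, hdiv']
  refine ⟨hodd, ⟨_, hk'⟩, ⟨_, hk⟩, by linarith, hk0, hsol, fun x y hx hy hxy => ?_⟩
  have hab : F (m + 1) ^ 2 < F (m + 2) ^ 2 := by
    rw [hrec]
    nlinarith
  exact hcop.pow.eq_of_linear_combination_eq (by linarith) (by linarith) (by linarith)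
    (by linarith) hx hy (hxy.trans hsol.symm)
end

section
/- Let n ≥ 2 be an integer with n ≡ 1 (mod 6). Then the quantities x = (F_n²−3)/2 and y = (F_n²−F_{n−1}²−1)/2 are nonnegative integers and 1 + F_n²·x + F_{n+1}²·y = (F_n²−1)(F_{n+1}²−1)/2. In particular (x, y) is the unique nonnegative integer solution of the equation 1 + F_n²·x + F_{n+1}²·y = (F_n²−1)(F_{n+1}²−1)/2. -/
theorem F_add_two (m : ℕ) : F (m + 2) = F m + F (m + 1) := by
  simp [F, Nat.fib_add_two]

/-- Cassini's identity at an odd index. -/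
theorem F_two_mul_add_one_sq (m : ℕ) :
    F (2 * m + 1) ^ 2 = F (2 * m) ^ 2 + F (2 * m) * F (2 * m + 1) + 1 := by
  induction m with
  | zero => simp [F]
  | succ k ih =>
    rw [show 2 * (k + 1) = 2 * k + 2 by ring, F_add_two (2 * k + 1), F_add_two (2 * k)]
    linear_combination ih

/-- A solution of `B * x + C * y = N` with `x < C` and `y < B` is the only nonnegative one. -/
theorem eq_of_mul_add_mul_eq {B C x y x₀ y₀ : ℤ} (hBC : IsCoprime B C) (hB : 0 < B) (hC : 0 < C)
    (hx : 0 ≤ x) (hy : 0 ≤ y) (hx₀ : x₀ < C) (hy₀ : y₀ < B)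
    (h : B * x + C * y = B * x₀ + C * y₀) : x = x₀ ∧ y = y₀ := by
  obtain ⟨t, ht⟩ : C ∣ x - x₀ :=
    hBC.symm.dvd_of_dvd_mul_left ⟨y₀ - y, by linear_combination h⟩
  have hyt : y₀ - y = B * t :=
    mul_left_cancel₀ hC.ne' (by linear_combination B * ht - h)
  have ht_nonneg : -1 < t := by
    by_contra! hlt
    nlinarith
  have ht_nonpos : t < 1 := by
    by_contra! hlt
    nlinarith
  obtain rfl : t = 0 := by omega
  constructor <;> linarith

theorem stmt_4 (n : ℕ) (hn : 2 ≤ n) (h6 : n % 6 = 1) :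
    2 ∣ (F n ^ 2 - 3) ∧ 2 ∣ (F n ^ 2 - F (n-1) ^ 2 - 1) ∧
    0 ≤ (F n ^ 2 - 3) / 2 ∧
    0 ≤ (F n ^ 2 - F (n-1) ^ 2 - 1) / 2 ∧
    1 + F n ^ 2 * ((F n ^ 2 - 3) / 2)
      + F (n+1) ^ 2 * ((F n ^ 2 - F (n-1) ^ 2 - 1) / 2)
      = (F n ^ 2 - 1) * (F (n+1) ^ 2 - 1) / 2 ∧
    (∀ x y : ℤ, 0 ≤ x → 0 ≤ y →
      1 + F n ^ 2 * x + F (n+1) ^ 2 * y = (F n ^ 2 - 1) * (F (n+1) ^ 2 - 1) / 2 →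
      x = (F n ^ 2 - 3) / 2 ∧ y = (F n ^ 2 - F (n-1) ^ 2 - 1) / 2) := by
  obtain ⟨k, rfl⟩ : ∃ k, n = 6 * k + 1 := ⟨n / 6, by omega⟩
  have hk : 1 ≤ k := by omega
  have hcassini : F (6 * k + 1) ^ 2 = F (6 * k) ^ 2 + F (6 * k) * F (6 * k + 1) + 1 := by
    have := F_two_mul_add_one_sq (3 * k)
    rwa [← mul_assoc] at this
  have heven : 2 ∣ F (6 * k) := by
    have := Nat.fib_dvd 3 (6 * k) ⟨2 * k, by ring⟩
    exact Int.natCast_dvd_natCast.mpr this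
  have ha : 0 < F (6 * k) := Int.natCast_pos.mpr (Nat.fib_pos.mpr (by omega))
  have hb : 0 < F (6 * k + 1) := Int.natCast_pos.mpr (Nat.fib_pos.mpr (by omega))
  have hcop : IsCoprime (F (6 * k + 1)) (F (6 * k + 1 + 1)) :=
    Nat.isCoprime_iff_coprime.mpr (Nat.fib_coprime_fib_succ (6 * k + 1))
  have hsucc : F (6 * k + 1 + 1) = F (6 * k) + F (6 * k + 1) := F_add_two (6 * k)
  rw [Nat.add_sub_cancel]
  rw [hsucc] at hcop ⊢
  generalize F (6 * k) = a at *
  generalize F (6 * k + 1) = b at *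
  obtain ⟨d, rfl⟩ := heven
  have hd : 1 ≤ d := by omega
  have hx₀ : b ^ 2 - 3 = 2 * (2 * d ^ 2 + d * b - 1) := by linear_combination hcassini
  have hy₀ : b ^ 2 - (2 * d) ^ 2 - 1 = 2 * (d * b) := by linear_combination hcassini
  have hrhs : (b ^ 2 - 1) * ((2 * d + b) ^ 2 - 1)
      = 2 * ((2 * d ^ 2 + d * b) * ((2 * d + b) ^ 2 - 1)) := by
    linear_combination ((2 * d + b) ^ 2 - 1) * hcassini
  have hdb : 0 < d * b := by positivity
  have hsol : 1 + b ^ 2 * (2 * d ^ 2 + d * b - 1) + (2 * d + b) ^ 2 * (d * b)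
      = (2 * d ^ 2 + d * b) * ((2 * d + b) ^ 2 - 1) := by
    linear_combination (2 * d ^ 2 + d * b - 1) * hcassini
  simp only [hx₀, hy₀, hrhs, Int.mul_ediv_cancel_left _ (two_ne_zero : (2 : ℤ) ≠ 0)]
  refine ⟨dvd_mul_right _ _, dvd_mul_right _ _, by nlinarith, hdb.le, hsol, ?_⟩
  intro x y hx hy h
  exact eq_of_mul_add_mul_eq (hcop.pow (m := 2) (n := 2)) (by positivity) (by positivity) hx hy
    (by nlinarith) (by nlinarith) (by linear_combination h - hsol)
end

section
/- Let n ≥ 2 be an integer with n ≡ 4 (mod 6). Then the quantities x = (F_n²+1)/2 and y = (F_n²−F_{n−1}²−1)/2 are nonnegative integers and 1 + F_n²·x + F_{n+1}²·y = (F_n²−1)(F_{n+1}²−1)/2. In particular (x, y) is the unique nonnegative integer solution of the equation 1 + F_n²·x + F_{n+1}²·y = (F_n²−1)(F_{n+1}²−1)/2. -/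
/-- Cassini's identity. -/
theorem F_mul_F_add_two_sub_sq (m : ℕ) : F m * F (m + 2) - F (m + 1) ^ 2 = (-1) ^ (m + 1) := by
  induction m with
  | zero => simp [F]
  | succ m ih =>
    rw [pow_succ (-1) (m + 1), ← ih, F_add_two (m + 1), F_add_two m]
    ring

/-- A linear Diophantine equation with coprime positive coefficients has at most one nonnegative
solution that is smaller than the opposite coefficients. -/
theorem eq_of_isCoprime_of_mul_add_mul_eq {b c x y x₀ y₀ : ℤ} (hbc : IsCoprime b c) (hb : 0 < b)
    (hc : 0 < c) (hx : 0 ≤ x) (hy : 0 ≤ y) (hx₀ : x₀ < c) (hy₀ : y₀ < b)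
    (h : b * x + c * y = b * x₀ + c * y₀) : x = x₀ ∧ y = y₀ := by
  obtain ⟨t, ht⟩ : b ∣ y₀ - y :=
    hbc.dvd_of_dvd_mul_left ⟨x - x₀, by linear_combination -h⟩
  have hxt : x = x₀ + c * t :=
    mul_left_cancel₀ hb.ne' (by linear_combination h + c * ht)
  have ht_lt : t < 1 := by nlinarith
  have ht_gt : -1 < t := by nlinarith
  obtain rfl : t = 0 := by lia
  constructor <;> linarith

theorem stmt_5 (n : ℕ) (hn : 2 ≤ n) (h6 : n % 6 = 4) :
    2 ∣ (F n ^ 2 + 1) ∧ 2 ∣ (F n ^ 2 - F (n-1) ^ 2 - 1) ∧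
    0 ≤ (F n ^ 2 + 1) / 2 ∧
    0 ≤ (F n ^ 2 - F (n-1) ^ 2 - 1) / 2 ∧
    1 + F n ^ 2 * ((F n ^ 2 + 1) / 2)
      + F (n+1) ^ 2 * ((F n ^ 2 - F (n-1) ^ 2 - 1) / 2)
      = (F n ^ 2 - 1) * (F (n+1) ^ 2 - 1) / 2 ∧
    (∀ x y : ℤ, 0 ≤ x → 0 ≤ y →
      1 + F n ^ 2 * x + F (n+1) ^ 2 * y = (F n ^ 2 - 1) * (F (n+1) ^ 2 - 1) / 2 →
      x = (F n ^ 2 + 1) / 2 ∧ y = (F n ^ 2 - F (n-1) ^ 2 - 1) / 2) := by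
  obtain ⟨m, rfl⟩ : ∃ m, n = m + 1 := ⟨n - 1, by lia⟩
  have hcassini := F_mul_F_add_two_sub_sq m
  rw [Even.neg_one_pow (Nat.even_iff.mpr (by lia))] at hcassini
  have hcop : IsCoprime (F (m + 1) ^ 2) (F (m + 1 + 1) ^ 2) :=
    (Nat.isCoprime_iff_coprime.mpr (Nat.fib_coprime_fib_succ (m + 1))).pow
  have ha_even : 2 ∣ F m :=
    Int.natCast_dvd_natCast.mpr (Nat.fib_dvd 3 m (by lia))
  have ha_pos : 0 < F m := Int.natCast_pos.mpr (Nat.fib_pos.mpr (by lia))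
  have hb_pos : 0 < F (m + 1) := Int.natCast_pos.mpr (Nat.fib_pos.mpr (by lia))
  have hc := F_add_two m
  simp only [Nat.add_sub_cancel, add_assoc, Nat.reduceAdd] at hcop ⊢
  generalize F m = a at *
  generalize F (m + 1) = b at *
  generalize F (m + 2) = c at *
  have hx : 2 ∣ b ^ 2 + 1 := by
    rw [show b ^ 2 + 1 = a * c by linear_combination -hcassini]
    exact ha_even.mul_right c
  have hy : 2 ∣ b ^ 2 - a ^ 2 - 1 := by
    rw [show b ^ 2 - a ^ 2 - 1 = a * b - 2 by linear_combination -hcassini + a * hc]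
    exact (ha_even.mul_right b).sub dvd_rfl
  have ha_two : 2 ≤ a := Int.le_of_dvd ha_pos ha_even
  have hy_nonneg : 0 ≤ b ^ 2 - a ^ 2 - 1 := by nlinarith
  obtain ⟨x₀, hx₀⟩ := hx
  obtain ⟨y₀, hy₀⟩ := hy
  have hsol : (b ^ 2 - 1) * (c ^ 2 - 1) = 2 * (1 + b ^ 2 * x₀ + c ^ 2 * y₀) := by
    linear_combination b ^ 2 * hx₀ + c ^ 2 * hy₀ + (a * c + b ^ 2 + 1) * hcassini
  rw [hsol, hx₀, hy₀]
  simp only [Int.mul_ediv_cancel_left _ (two_ne_zero : (2 : ℤ) ≠ 0)]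
  refine ⟨dvd_mul_right _ _, dvd_mul_right _ _, by nlinarith, by linarith, by ring,
    fun x y hx hy h ↦ ?_⟩
  exact eq_of_isCoprime_of_mul_add_mul_eq hcop (by positivity) (by nlinarith) hx hy
    (by nlinarith) (by nlinarith) (by linarith)
end

section
/- For every integer n ≥ 2, (Σ_{i=1}^{2n−1} (−1)^{i−1} F_i³) · F_{2n−1}³ + (Σ_{i=2}^{2n−2} F_i³) · F_{2n}³ = (F_{2n−1}³ − 1)(F_{2n}³ − 1)/2, where both sums are nonnegative integers and the right-hand side is an integer. -/
theorem F_nonneg (m : ℕ) : 0 ≤ F m := by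
  simp [F]

theorem F_cassini_odd (k : ℕ) :
    F (2*k+2) ^ 2 - F (2*k+1) * F (2*k+2) - F (2*k+1) ^ 2 = -1 := by
  induction k with
  | zero => decide
  | succ k ih =>
    have h3 : F (2*(k+1)+1) = F (2*k+1) + F (2*k+2) := F_add_two (2*k+1)
    have h4 : F (2*(k+1)+2) = F (2*k+2) + F (2*(k+1)+1) := F_add_two (2*k+2)
    rw [h4, h3]
    linear_combination ih

theorem two_mul_sum_alternating_F_cube (k : ℕ) :
    2 * ∑ i ∈ Finset.Icc 1 (2*k+1), (-1 : ℤ) ^ (i-1) * F i ^ 3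
      = F (2*k+1) ^ 2 * F (2*k+2) + F (2*k+1) + F (2*k+2) - 1 := by
  induction k with
  | zero => decide
  | succ k ih =>
    have h3 : F (2*(k+1)+1) = F (2*k+1) + F (2*k+2) := F_add_two (2*k+1)
    have h4 : F (2*(k+1)+2) = F (2*k+2) + F (2*(k+1)+1) := F_add_two (2*k+2)
    have hsum : ∑ i ∈ Finset.Icc 1 (2*(k+1)+1), (-1 : ℤ) ^ (i-1) * F i ^ 3
        = ∑ i ∈ Finset.Icc 1 (2*k+1), (-1 : ℤ) ^ (i-1) * F i ^ 3
          - F (2*k+2) ^ 3 + F (2*(k+1)+1) ^ 3 := by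
      rw [show 2*(k+1)+1 = 2*k+1+1+1 by ring, Finset.sum_Icc_succ_top (by omega),
        Finset.sum_Icc_succ_top (by omega)]
      simp [pow_succ, pow_mul]
      ring
    rw [hsum, h4, h3]
    linear_combination ih - (F (2*k+1) + 2 * F (2*k+2)) * F_cassini_odd k

theorem two_mul_sum_F_cube (k : ℕ) :
    2 * ∑ i ∈ Finset.Icc 2 (2*k+2), F i ^ 3
      = (F (2*k+4) - F (2*k+3)) * F (2*k+3) ^ 2 - 2 * F (2*k+3) + F (2*k+4) - 1 := by
  induction k with
  | zero => decide
  | succ k ih =>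
    have h5 : F (2*(k+1)+3) = F (2*k+3) + F (2*k+4) := F_add_two (2*k+3)
    have h6 : F (2*(k+1)+4) = F (2*k+4) + F (2*(k+1)+3) := F_add_two (2*k+4)
    rw [show 2*(k+1)+2 = 2*k+2+1+1 by ring, Finset.sum_Icc_succ_top (by omega),
      Finset.sum_Icc_succ_top (by omega), h6, h5]
    linear_combination ih - (F (2*k+3) - F (2*k+4)) * F_cassini_odd (k+1)

theorem stmt_6 (n : ℕ) (hn : 2 ≤ n) :
    0 ≤ ∑ i ∈ Finset.Icc 1 (2*n-1), (-1 : ℤ) ^ (i-1) * F i ^ 3 ∧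
    0 ≤ ∑ i ∈ Finset.Icc 2 (2*n-2), F i ^ 3 ∧
    2 ∣ (F (2*n-1) ^ 3 - 1) * (F (2*n) ^ 3 - 1) ∧
    (∑ i ∈ Finset.Icc 1 (2*n-1), (-1 : ℤ) ^ (i-1) * F i ^ 3) * F (2*n-1) ^ 3
      + (∑ i ∈ Finset.Icc 2 (2*n-2), F i ^ 3) * F (2*n) ^ 3
      = (F (2*n-1) ^ 3 - 1) * (F (2*n) ^ 3 - 1) / 2 := by
  obtain ⟨k, rfl⟩ : ∃ k, n = k + 2 := ⟨n - 2, by omega⟩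
  rw [show 2*(k+2)-1 = 2*k+3 by omega, show 2*(k+2)-2 = 2*k+2 by omega,
    show 2*(k+2) = 2*k+4 by ring]
  have hS : 2 * ∑ i ∈ Finset.Icc 1 (2*k+3), (-1 : ℤ) ^ (i-1) * F i ^ 3
      = F (2*k+3) ^ 2 * F (2*k+4) + F (2*k+3) + F (2*k+4) - 1 :=
    two_mul_sum_alternating_F_cube (k+1)
  have hT := two_mul_sum_F_cube k
  have hq : F (2*k+4) ^ 2 - F (2*k+3) * F (2*k+4) - F (2*k+3) ^ 2 = -1 :=
    F_cassini_odd (k+1)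
  have ha := F_nonneg (2*k+3)
  have hb : 1 ≤ F (2*k+4) := by
    have : 0 < Nat.fib (2*k+4) := Nat.fib_pos.2 (by omega)
    unfold F
    omega
  have hT0 : 0 ≤ ∑ i ∈ Finset.Icc 2 (2*k+2), F i ^ 3 :=
    Finset.sum_nonneg fun i _ => pow_nonneg (F_nonneg i) 3
  generalize ∑ i ∈ Finset.Icc 1 (2*k+3), (-1 : ℤ) ^ (i-1) * F i ^ 3 = S at *
  generalize ∑ i ∈ Finset.Icc 2 (2*k+2), F i ^ 3 = T at *
  generalize F (2*k+3) = a at *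
  generalize F (2*k+4) = b at *
  have hmain : (a ^ 3 - 1) * (b ^ 3 - 1) = 2 * (S * a ^ 3 + T * b ^ 3) := by
    linear_combination -a ^ 3 * hS - b ^ 3 * hT - (a ^ 2 + 1) * (b ^ 2 - a * b - 1) * hq
  have hab : 0 ≤ a ^ 2 * b := by positivity
  refine ⟨by linarith, hT0, ⟨_, hmain⟩, ?_⟩
  rw [hmain, Int.mul_ediv_cancel_left _ two_ne_zero]
end

section
/- For every integer n ≥ 2, 1 + (Σ_{i=1}^{2n} (−1)^{i} F_i³ − 1) · F_{2n}³ + (Σ_{i=2}^{2n−1} F_i³) · F_{2n+1}³ = (F_{2n}³ − 1)(F_{2n+1}³ − 1)/2, where Σ_{i=1}^{2n} (−1)^{i} F_i³ − 1 and Σ_{i=2}^{2n−1} F_i³ are nonnegative integers and the right-hand side is an integer. -/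
theorem F_cassini (n : ℕ) :
    F (2*n+1) ^ 2 - F (2*n) * F (2*n+1) - F (2*n) ^ 2 = 1 := by
  induction n with
  | zero => simp [F]
  | succ n ih =>
    have h₁ : F (2*(n+1)) = F (2*n) + F (2*n+1) := F_add_two (2*n)
    have h₂ : F (2*(n+1)+1) = F (2*n+1) + F (2*(n+1)) := F_add_two (2*n+1)
    rw [h₂, h₁]
    linear_combination ih

theorem two_mul_sum_alternating_F_cubed (n : ℕ) :
    2 * ∑ i ∈ Finset.Icc 1 (2*n), (-1 : ℤ) ^ i * F i ^ 3
      = F (2*n) ^ 2 * F (2*n+1) - F (2*n) - F (2*n+1) + 1 := by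
  induction n with
  | zero => simp [F]
  | succ n ih =>
    have h₁ : F (2*n+1+1) = F (2*n) + F (2*n+1) := F_add_two (2*n)
    have h₂ : F (2*n+1+1+1) = F (2*n+1) + F (2*n+1+1) := F_add_two (2*n+1)
    have e : (-1 : ℤ) ^ (2*n) = 1 := by simp
    rw [show 2*(n+1) = 2*n+1+1 by ring, Finset.sum_Icc_succ_top (by omega),
      Finset.sum_Icc_succ_top (by omega), pow_succ (-1 : ℤ) (2*n+1), pow_succ (-1 : ℤ) (2*n),
      e, h₂, h₁]
    linear_combination ih - (F (2*n) + 2 * F (2*n+1)) * F_cassini n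

theorem two_mul_sum_F_cubed (n : ℕ) (hn : 1 ≤ n) :
    2 * ∑ i ∈ Finset.Icc 2 (2*n-1), F i ^ 3
      = F (2*n) * F (2*n+1) ^ 2 - F (2*n+1) + F (2*n) - 1 - 2 * F (2*n) ^ 3 := by
  induction n, hn using Nat.le_induction with
  | base => simp [F, Nat.fib_add_two]
  | succ n hn ih =>
    have h₁ : F (2*(n+1)) = F (2*n) + F (2*n+1) := F_add_two (2*n)
    have h₂ : F (2*(n+1)+1) = F (2*n+1) + F (2*(n+1)) := F_add_two (2*n+1)
    rw [show 2*(n+1)-1 = 2*n-1+1+1 by omega, Finset.sum_Icc_succ_top (by omega),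
      Finset.sum_Icc_succ_top (by omega), show 2*n-1+1 = 2*n by omega, h₂, h₁]
    linear_combination ih - F (2*n) * F_cassini n

theorem stmt_7 (n : ℕ) (hn : 2 ≤ n) :
    0 ≤ (∑ i ∈ Finset.Icc 1 (2*n), (-1 : ℤ) ^ i * F i ^ 3) - 1 ∧
    0 ≤ ∑ i ∈ Finset.Icc 2 (2*n-1), F i ^ 3 ∧
    2 ∣ (F (2*n) ^ 3 - 1) * (F (2*n+1) ^ 3 - 1) ∧
    1 + ((∑ i ∈ Finset.Icc 1 (2*n), (-1 : ℤ) ^ i * F i ^ 3) - 1) * F (2*n) ^ 3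
      + (∑ i ∈ Finset.Icc 2 (2*n-1), F i ^ 3) * F (2*n+1) ^ 3
      = (F (2*n) ^ 3 - 1) * (F (2*n+1) ^ 3 - 1) / 2 := by
  have hA := two_mul_sum_alternating_F_cubed n
  have hB := two_mul_sum_F_cubed n (by omega)
  have hc := F_cassini n
  have ha : 3 ≤ F (2*n) := by
    have : Nat.fib 4 ≤ Nat.fib (2*n) := Nat.fib_mono (by omega)
    exact Int.ofNat_le.mpr this
  have hab : F (2*n) ≤ F (2*n+1) := Int.ofNat_le.mpr Nat.fib_le_fib_succ
  have hB_nonneg : 0 ≤ ∑ i ∈ Finset.Icc 2 (2*n-1), F i ^ 3 :=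
    Finset.sum_nonneg fun i _ => pow_nonneg (Int.natCast_nonneg _) 3
  generalize (∑ i ∈ Finset.Icc 1 (2*n), (-1 : ℤ) ^ i * F i ^ 3) = A at *
  generalize (∑ i ∈ Finset.Icc 2 (2*n-1), F i ^ 3) = B at *
  generalize F (2*n) = a at *
  generalize F (2*n+1) = b at *
  have key : (a ^ 3 - 1) * (b ^ 3 - 1) = 2 * (1 + (A - 1) * a ^ 3 + B * b ^ 3) := by
    linear_combination -a ^ 3 * hA - b ^ 3 * hB
      - (a * b * (b ^ 2 - a * b - a ^ 2) + 2 * (a * b) ^ 2 - (b ^ 2 - a * b - a ^ 2) - 1) * hc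
  refine ⟨?_, hB_nonneg, ⟨_, key⟩, ?_⟩
  · have : 9 * b ≤ a ^ 2 * b := mul_le_mul_of_nonneg_right (by nlinarith) (by linarith)
    linarith
  · rw [key, Int.mul_ediv_cancel_left _ two_ne_zero]
end

section
/- For every integer n ≥ 1, B_{2n−1} is odd, and the pair (x, y) = ((B_{2n−1}−1)/2, b_{2n−1}) consists of nonnegative integers satisfying B_{2n−1}·x + B_{2n}·y = (B_{2n−1}−1)(B_{2n}−1)/2; equivalently, B_{2n−1}(B_{2n−1}−1) + 2·B_{2n}·b_{2n−1} = (B_{2n−1}−1)(B_{2n}−1). -/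
theorem balancing_invariants (B b : ℕ → ℤ)
    (hB1 : B 1 = 1) (hB2 : B 2 = 6)
    (hBrec : ∀ m : ℕ, 3 ≤ m → B m = 6 * B (m-1) - B (m-2))
    (hb1 : b 1 = 0) (hb2 : b 2 = 2)
    (hbrec : ∀ m : ℕ, 3 ≤ m → b m = 6 * b (m-1) - b (m-2) + 2) (k : ℕ) :
    1 ≤ B (k+1) ∧ 5 * B (k+1) + 1 ≤ B (k+2) ∧
    B (k+2) ^ 2 - 6 * B (k+1) * B (k+2) + B (k+1) ^ 2 = 1 ∧
    2 * b (k+1) + 1 = B (k+2) - 5 * B (k+1) ∧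
    2 * b (k+2) + 1 = B (k+2) - B (k+1) := by
  induction k with
  | zero => simp [hB1, hB2, hb1, hb2]
  | succ k ih =>
    obtain ⟨h1, h2, h3, h4, h5⟩ := ih
    have hB : B (k+3) = 6 * B (k+2) - B (k+1) := hBrec (k+3) (by omega)
    have hb : b (k+3) = 6 * b (k+2) - b (k+1) + 2 := hbrec (k+3) (by omega)
    change 1 ≤ B (k+2) ∧ 5 * B (k+2) + 1 ≤ B (k+3) ∧
      B (k+3) ^ 2 - 6 * B (k+2) * B (k+3) + B (k+2) ^ 2 = 1 ∧
      2 * b (k+2) + 1 = B (k+3) - 5 * B (k+2) ∧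
      2 * b (k+3) + 1 = B (k+3) - B (k+2)
    rw [hB, hb]
    refine ⟨by linarith, by linarith, by linear_combination h3, by linarith, by linarith⟩

theorem odd_balancing (B : ℕ → ℤ) (hB1 : B 1 = 1)
    (hBrec : ∀ m : ℕ, 3 ≤ m → B m = 6 * B (m-1) - B (m-2)) (k : ℕ) :
    Odd (B (2*k+1)) := by
  induction k with
  | zero => simp [hB1]
  | succ k ih =>
    have hB : B (2*(k+1)+1) = 6 * B (2*k+2) - B (2*k+1) := hBrec (2*k+3) (by omega)
    obtain ⟨t, ht⟩ := ih
    exact ⟨3 * B (2*k+2) - t - 1, by rw [hB, ht]; ring⟩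

theorem stmt_8 (B b : ℕ → ℤ)
    (hB1 : B 1 = 1) (hB2 : B 2 = 6)
    (hBrec : ∀ m : ℕ, 3 ≤ m → B m = 6 * B (m-1) - B (m-2))
    (hb1 : b 1 = 0) (hb2 : b 2 = 2)
    (hbrec : ∀ m : ℕ, 3 ≤ m → b m = 6 * b (m-1) - b (m-2) + 2)
    (n : ℕ) (hn : 1 ≤ n) :
    Odd (B (2*n-1)) ∧
    0 ≤ (B (2*n-1) - 1) / 2 ∧
    0 ≤ b (2*n-1) ∧
    B (2*n-1) * ((B (2*n-1) - 1) / 2) + B (2*n) * b (2*n-1)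
      = (B (2*n-1) - 1) * (B (2*n) - 1) / 2 ∧
    B (2*n-1) * (B (2*n-1) - 1) + 2 * B (2*n) * b (2*n-1)
      = (B (2*n-1) - 1) * (B (2*n) - 1) := by
  obtain ⟨k, rfl⟩ : ∃ k, n = k + 1 := ⟨n - 1, by omega⟩
  have hodd := odd_balancing B hB1 hBrec k
  obtain ⟨h1, h2, h3, h4, -⟩ := balancing_invariants B b hB1 hB2 hBrec hb1 hb2 hbrec (2*k)
  rw [show 2 * (k + 1) - 1 = 2 * k + 1 by omega, show 2 * (k + 1) = 2 * k + 2 by ring]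
  have key : B (2*k+1) * (B (2*k+1) - 1) + 2 * B (2*k+2) * b (2*k+1)
      = (B (2*k+1) - 1) * (B (2*k+2) - 1) := by
    linear_combination h3 + B (2*k+2) * h4
  refine ⟨hodd, by omega, by omega, ?_, key⟩
  obtain ⟨t, ht⟩ := hodd
  have hhalf : (B (2*k+1) - 1) / 2 = t := by omega
  rw [hhalf]
  symm
  apply Int.ediv_eq_of_eq_mul_right two_ne_zero
  rw [← key]
  linear_combination B (2*k+1) * ht
end

section
/- For every integer n ≥ 1, the pair (x, y) = (b_{2n+1}, (B_{2n−1}−1)/2) consists of nonnegative integers satisfying 1 + B_{2n}·x + B_{2n+1}·y = (B_{2n}−1)(B_{2n+1}−1)/2; equivalently, 2 + 2·B_{2n}·b_{2n+1} + B_{2n+1}(B_{2n−1}−1) = (B_{2n}−1)(B_{2n+1}−1). -/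
lemma balancing_pos_and_lt {B : ℕ → ℤ} (hB1 : B 1 = 1) (hB2 : B 2 = 6)
    (hBrec : ∀ m : ℕ, 3 ≤ m → B m = 6 * B (m-1) - B (m-2)) (k : ℕ) :
    0 < B (k+1) ∧ B (k+1) < B (k+2) := by
  induction k with
  | zero => simp [hB1, hB2]
  | succ k ih =>
    have h : B (k+3) = 6 * B (k+2) - B (k+1) := hBrec (k+3) (by lia)
    change 0 < B (k+2) ∧ B (k+2) < B (k+3)
    lia

lemma balancing_cassini {B : ℕ → ℤ} (hB1 : B 1 = 1) (hB2 : B 2 = 6)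
    (hBrec : ∀ m : ℕ, 3 ≤ m → B m = 6 * B (m-1) - B (m-2)) (k : ℕ) :
    B (k+2) ^ 2 - B (k+3) * B (k+1) = 1 := by
  induction k with
  | zero =>
    have h : B 3 = 6 * B 2 - B 1 := hBrec 3 le_rfl
    norm_num [h, hB1, hB2]
  | succ k ih =>
    have h : B (k+3) = 6 * B (k+2) - B (k+1) := hBrec (k+3) (by lia)
    have h' : B (k+4) = 6 * B (k+3) - B (k+2) := hBrec (k+4) (by lia)
    change B (k+3) ^ 2 - B (k+4) * B (k+2) = 1
    rw [h', ← ih]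
    linear_combination B (k+3) * h

lemma balancing_odd_index {B : ℕ → ℤ} (hB1 : B 1 = 1)
    (hBrec : ∀ m : ℕ, 3 ≤ m → B m = 6 * B (m-1) - B (m-2)) (k : ℕ) :
    Odd (B (2*k+1)) := by
  induction k with
  | zero => simp [hB1]
  | succ k ih =>
    have h : B (2*k+3) = 6 * B (2*k+2) - B (2*k+1) := hBrec (2*k+3) (by lia)
    change Odd (B (2*k+3))
    grind

lemma two_mul_cobalancing_add_one {B b : ℕ → ℤ} (hB1 : B 1 = 1) (hB2 : B 2 = 6)
    (hBrec : ∀ m : ℕ, 3 ≤ m → B m = 6 * B (m-1) - B (m-2))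
    (hb1 : b 1 = 0) (hb2 : b 2 = 2)
    (hbrec : ∀ m : ℕ, 3 ≤ m → b m = 6 * b (m-1) - b (m-2) + 2) (k : ℕ) :
    2 * b (k+2) + 1 = B (k+2) - B (k+1) := by
  induction k using Nat.twoStepInduction with
  | zero => simp [hB1, hB2, hb2]
  | one =>
    have h : B 3 = 6 * B 2 - B 1 := hBrec 3 le_rfl
    have h' : b 3 = 6 * b 2 - b 1 + 2 := hbrec 3 le_rfl
    norm_num [h, h', hB1, hB2, hb1, hb2]
  | more k ih ih' =>
    have h : B (k+3) = 6 * B (k+2) - B (k+1) := hBrec (k+3) (by lia)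
    have h' : B (k+4) = 6 * B (k+3) - B (k+2) := hBrec (k+4) (by lia)
    have h'' : b (k+4) = 6 * b (k+3) - b (k+2) + 2 := hbrec (k+4) (by lia)
    change 2 * b (k+3) + 1 = B (k+3) - B (k+2) at ih'
    change 2 * b (k+4) + 1 = B (k+4) - B (k+3)
    lia

theorem stmt_9 (B b : ℕ → ℤ)
    (hB1 : B 1 = 1) (hB2 : B 2 = 6)
    (hBrec : ∀ m : ℕ, 3 ≤ m → B m = 6 * B (m-1) - B (m-2))
    (hb1 : b 1 = 0) (hb2 : b 2 = 2)
    (hbrec : ∀ m : ℕ, 3 ≤ m → b m = 6 * b (m-1) - b (m-2) + 2)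
    (n : ℕ) (hn : 1 ≤ n) :
    0 ≤ b (2*n+1) ∧
    0 ≤ (B (2*n-1) - 1) / 2 ∧
    1 + B (2*n) * b (2*n+1) + B (2*n+1) * ((B (2*n-1) - 1) / 2)
      = (B (2*n) - 1) * (B (2*n+1) - 1) / 2 ∧
    2 + 2 * B (2*n) * b (2*n+1) + B (2*n+1) * (B (2*n-1) - 1)
      = (B (2*n) - 1) * (B (2*n+1) - 1) := by
  obtain ⟨k, rfl⟩ := Nat.exists_eq_add_of_le' hn
  change 0 ≤ b (2*k+3) ∧ 0 ≤ (B (2*k+1) - 1) / 2 ∧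
    1 + B (2*k+2) * b (2*k+3) + B (2*k+3) * ((B (2*k+1) - 1) / 2)
      = (B (2*k+2) - 1) * (B (2*k+3) - 1) / 2 ∧
    2 + 2 * B (2*k+2) * b (2*k+3) + B (2*k+3) * (B (2*k+1) - 1)
      = (B (2*k+2) - 1) * (B (2*k+3) - 1)
  have hpos : 0 < B (2*k+1) := (balancing_pos_and_lt hB1 hB2 hBrec (2*k)).1
  have hlt : B (2*k+2) < B (2*k+3) := (balancing_pos_and_lt hB1 hB2 hBrec (2*k+1)).2
  have hcassini := balancing_cassini hB1 hB2 hBrec (2*k)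
  have hb : 2 * b (2*k+3) + 1 = B (2*k+3) - B (2*k+2) :=
    two_mul_cobalancing_add_one hB1 hB2 hBrec hb1 hb2 hbrec (2*k+1)
  obtain ⟨c, hc⟩ := balancing_odd_index hB1 hBrec k
  have hmain : 2 + 2 * B (2*k+2) * b (2*k+3) + B (2*k+3) * (B (2*k+1) - 1)
      = (B (2*k+2) - 1) * (B (2*k+3) - 1) := by
    linear_combination B (2*k+2) * hb - hcassini
  have hhalf : (B (2*k+1) - 1) / 2 = c := by lia
  refine ⟨by lia, by lia, ?_, hmain⟩
  rw [hhalf, ← hmain, hc]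
  symm
  apply Int.ediv_eq_of_eq_mul_right two_ne_zero
  ring
end

section
/- Let u and v be positive integers with gcd(u,v) = 1 and u even, and let k be an odd integer with 1 ≤ k ≤ 2u−1. Then there is a unique odd integer r with 1 ≤ r ≤ u such that v·r ≡ k (mod 2u) or v·r ≡ −k (mod 2u). -/
theorem stmt_11 (u v : ℕ) (hu : 0 < u) (hv : 0 < v) (hcop : Nat.Coprime u v)
    (hueven : Even u) (k : ℕ) (hkodd : Odd k) (hk1 : 1 ≤ k) (hk2 : k ≤ 2*u - 1) :
    ∃! r : ℕ, Odd r ∧ 1 ≤ r ∧ r ≤ u ∧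
      (((v : ℤ) * r) ≡ (k : ℤ) [ZMOD (2*u : ℤ)] ∨
       ((v : ℤ) * r) ≡ -(k : ℤ) [ZMOD (2*u : ℤ)]) := by
  have hvodd : Odd v := by
    rw [← Nat.coprime_two_left]
    exact hcop.coprime_dvd_left hueven.two_dvd
  have hcop' : IsCoprime (2 * u : ℤ) (v : ℤ) := by
    have h : Nat.Coprime (2 * u) v :=
      Nat.Coprime.mul_left (Nat.coprime_two_left.mpr hvodd) hcop
    exact_mod_cast Nat.isCoprime_iff_coprime.mpr h
  have hupos : (0 : ℤ) < 2 * u := by positivity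
  apply existsUnique_of_exists_of_unique
  · obtain ⟨a, w, haw⟩ := hcop'
    obtain ⟨s, hs⟩ : ∃ s : ℤ, s = (w * k) % (2 * u) := ⟨_, rfl⟩
    have hs0 : 0 ≤ s := hs ▸ Int.emod_nonneg _ hupos.ne'
    have hs1 : s < 2 * u := hs ▸ Int.emod_lt_of_pos _ hupos
    have hdvd : (2 * u : ℤ) ∣ k - v * s := by
      refine ⟨a * k + v * (w * k / (2 * u)), ?_⟩
      have h := Int.mul_ediv_add_emod (w * k) (2 * u)
      rw [← hs] at h
      linear_combination (-(k : ℤ)) * haw - (v : ℤ) * h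
    have hsodd : Odd s := by
      have heven : Even ((k : ℤ) - v * s) :=
        even_iff_two_dvd.mpr ((Dvd.intro _ rfl).trans hdvd)
      have hk : Odd (k : ℤ) := by exact_mod_cast hkodd
      have hmul : Odd ((v : ℤ) * s) := (Int.even_sub'.mp heven).mp hk
      exact (Int.odd_mul.mp hmul).2
    lift s to ℕ using hs0
    have hsodd' : Odd s := by exact_mod_cast hsodd
    have hspos := hsodd'.pos
    by_cases hsu : s ≤ u
    · exact ⟨s, hsodd', hspos, hsu, Or.inl (Int.modEq_iff_dvd.mpr hdvd)⟩
    · have hle : s ≤ 2 * u := by omega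
      refine ⟨2 * u - s, Nat.Even.sub_odd hle (even_two_mul u) hsodd',
        by omega, by omega, Or.inr (Int.modEq_iff_dvd.mpr ?_)⟩
      obtain ⟨c, hc⟩ := hdvd
      refine ⟨-c - v, ?_⟩
      push_cast [Nat.cast_sub hle]
      linear_combination -hc
  · rintro r t ⟨hr, hr1, hru, hrk⟩ ⟨ht, ht1, htu, htk⟩
    have hkey : (2 * u : ℤ) ∣ r - t ∨ (2 * u : ℤ) ∣ r + t := by
      have hsub : (2 * u : ℤ) ∣ v * (r - t) ∨ (2 * u : ℤ) ∣ v * (r + t) := by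
        simp only [Int.modEq_iff_dvd] at hrk htk
        rcases hrk with ⟨c, hc⟩ | ⟨c, hc⟩ <;> rcases htk with ⟨d, hd⟩ | ⟨d, hd⟩
        · exact Or.inl ⟨d - c, by linear_combination hd - hc⟩
        · exact Or.inr ⟨-d - c, by linear_combination -hd - hc⟩
        · exact Or.inr ⟨-d - c, by linear_combination -hd - hc⟩
        · exact Or.inl ⟨d - c, by linear_combination hd - hc⟩
      exact hsub.imp hcop'.dvd_of_dvd_mul_left hcop'.dvd_of_dvd_mul_left
    rcases hkey with h | h
    · have h0 := Int.eq_zero_of_abs_lt_dvd h (by rw [abs_lt]; constructor <;> omega)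
      omega
    · have hle := Int.le_of_dvd (by omega) h
      have hreq : r = u := by omega
      exact absurd (hreq ▸ hueven) (Nat.not_even_iff_odd.mpr hr)
end

section
/- Let u and v be positive integers with gcd(u,v) = 1 and u odd, let r be an even integer with 0 ≤ r ≤ u−1 such that v·r ≡ −1 (mod u), and let n = 6k+6 for some integer k ≥ 0. Set t_n = u·F_{n−2} + v·F_{n−1} and t_{n+1} = u·F_{n−1} + v·F_n. Then x = (1/2)((u−r)·F_{n−1} + (((u−r)·v−1)/u)·F_n − 1) and y = (1/2)(r·F_{n−2} + ((v·r+1)/u)·F_{n−1} − 1) are nonnegative integers (in particular u divides (u−r)v−1 and u divides vr+1, and the displayed halves are integers), and t_n·x + t_{n+1}·y = (t_n−1)(t_{n+1}−1)/2. -/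
theorem F_succ_pos (m : ℕ) : 0 < F (m + 1) := by
  simp [F, Nat.fib_pos]

/-- The Cassini identity at an odd index, in terms of two consecutive Fibonacci numbers. -/
theorem F_sq_add_mul_sub_sq (m : ℕ) :
    F (2 * m + 1) ^ 2 + F (2 * m + 1) * F (2 * m + 2) - F (2 * m + 2) ^ 2 = 1 := by
  induction m with
  | zero => simp [F]
  | succ m ih =>
    have h3 : F (2 * (m + 1) + 1) = F (2 * m + 1) + F (2 * m + 2) := F_add_two (2 * m + 1)
    have h4 : F (2 * (m + 1) + 2) = F (2 * m + 2) + F (2 * (m + 1) + 1) := F_add_two (2 * m + 2)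
    rw [h4, h3]
    linear_combination ih

theorem even_F_three_mul (m : ℕ) : Even (F (3 * m)) := by
  rw [F, Int.even_coe_nat, even_iff_two_dvd]
  exact Nat.fib_dvd 3 (3 * m) (Dvd.intro m rfl)

theorem stmt_14 (u v : ℕ) (hu : 0 < u) (hv : 0 < v) (hcop : Nat.Coprime u v)
    (huodd : Odd u) (r : ℤ) (hreven : Even r) (hr0 : 0 ≤ r) (hr1 : r ≤ (u : ℤ) - 1)
    (hmod : (v : ℤ) * r ≡ -1 [ZMOD (u : ℤ)])
    (n k : ℕ) (hn : n = 6*k + 6) :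
    (u : ℤ) ∣ (((u : ℤ) - r) * v - 1) ∧
    (u : ℤ) ∣ ((v : ℤ) * r + 1) ∧
    2 ∣ (((u : ℤ) - r) * F (n-1) + ((((u : ℤ) - r) * v - 1) / u) * F n - 1) ∧
    2 ∣ (r * F (n-2) + (((v : ℤ) * r + 1) / u) * F (n-1) - 1) ∧
    0 ≤ (((u : ℤ) - r) * F (n-1) + ((((u : ℤ) - r) * v - 1) / u) * F n - 1) / 2 ∧
    0 ≤ (r * F (n-2) + (((v : ℤ) * r + 1) / u) * F (n-1) - 1) / 2 ∧
    ((u : ℤ) * F (n-2) + v * F (n-1)) *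
        ((((u : ℤ) - r) * F (n-1) + ((((u : ℤ) - r) * v - 1) / u) * F n - 1) / 2)
      + ((u : ℤ) * F (n-1) + v * F n) *
        ((r * F (n-2) + (((v : ℤ) * r + 1) / u) * F (n-1) - 1) / 2)
      = (((u : ℤ) * F (n-2) + v * F (n-1)) - 1) * (((u : ℤ) * F (n-1) + v * F n) - 1) / 2 := by
  obtain ⟨s, hs⟩ : (u : ℤ) ∣ (v : ℤ) * r + 1 := by
    simpa using hmod.symm.dvd
  have hu' : (0 : ℤ) < u := by exact_mod_cast hu
  have hv' : (0 : ℤ) < v := by exact_mod_cast hv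
  have hw : ((u : ℤ) - r) * v - 1 = u * (v - s) := by linear_combination -hs
  have hs_pos : 0 < s := by
    have : 0 < (u : ℤ) * s := by rw [← hs]; positivity
    exact pos_of_mul_pos_right this hu'.le
  have hs_le : s ≤ v := by
    refine le_of_mul_le_mul_left ?_ hu'
    nlinarith
  have hs_odd : Odd s := by
    have : Odd ((u : ℤ) * s) := by rw [← hs]; exact (hreven.mul_left _).add_one
    exact (Int.odd_mul.mp this).2
  have hu_odd : Odd (u : ℤ) := by exact_mod_cast huodd
  have h1 : n - 1 = 6 * k + 5 := by omega
  have h2 : n - 2 = 6 * k + 4 := by omega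
  rw [hs, hw, Int.mul_ediv_cancel_left _ hu'.ne', Int.mul_ediv_cancel_left _ hu'.ne', h1, h2, hn]
  have hrec : F (6 * k + 6) = F (6 * k + 4) + F (6 * k + 5) := F_add_two _
  have hcassini : F (6 * k + 5) ^ 2 + F (6 * k + 5) * F (6 * k + 6) - F (6 * k + 6) ^ 2 = 1 := by
    convert F_sq_add_mul_sub_sq (3 * k + 2) using 4 <;> ring_nf
  have hb_even : Even (F (6 * k + 6)) := by
    convert even_F_three_mul (2 * k + 2) using 2; ring
  have ha_pos : 0 < F (6 * k + 5) := F_succ_pos _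
  have hb_nonneg := F_nonneg (6 * k + 6)
  have hc_nonneg := F_nonneg (6 * k + 4)
  generalize F (6 * k + 4) = c at *
  generalize F (6 * k + 5) = a at *
  generalize F (6 * k + 6) = b at *
  have ha_odd : Odd a := by
    have : Odd (a ^ 2) := by
      rw [show a ^ 2 = b * (b - a) + 1 by linear_combination hcassini]
      exact (hb_even.mul_right _).add_one
    exact Int.odd_pow' two_ne_zero |>.mp this
  have hx_even : 2 ∣ ((u : ℤ) - r) * a + (v - s) * b - 1 :=
    ((((hu_odd.sub_even hreven).mul ha_odd).add_even (hb_even.mul_left _)).sub_odd odd_one).two_dvd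
  have hy_even : 2 ∣ r * c + s * a - 1 :=
    (((hreven.mul_right c).add_odd (hs_odd.mul ha_odd)).sub_odd odd_one).two_dvd
  have hx_nonneg : 0 ≤ ((u : ℤ) - r) * a + (v - s) * b - 1 := by
    have : 0 < ((u : ℤ) - r) * a := mul_pos (by linarith) ha_pos
    have : 0 ≤ ((v : ℤ) - s) * b := mul_nonneg (by linarith) hb_nonneg
    omega
  have hy_nonneg : 0 ≤ r * c + s * a - 1 := by
    have : 0 ≤ r * c := mul_nonneg hr0 hc_nonneg
    have : 0 < s * a := mul_pos hs_pos ha_pos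
    omega
  refine ⟨dvd_mul_right _ _, dvd_mul_right _ _, hx_even, hy_even, by omega, by omega, ?_⟩
  obtain ⟨x, hx⟩ := hx_even
  obtain ⟨y, hy⟩ := hy_even
  rw [hx, hy, Int.mul_ediv_cancel_left _ two_ne_zero, Int.mul_ediv_cancel_left _ two_ne_zero]
  refine (Int.ediv_eq_of_eq_mul_right two_ne_zero ?_).symm
  obtain rfl : c = b - a := by linarith
  linear_combination (u * (b - a) + v * a) * hx + (u * a + v * b) * hy - hcassini
    + (a ^ 2 + a * b - b ^ 2) * hs
end

section
/- Let u and v be positive integers with gcd(u,v) = 1 and u odd, let r be an odd integer with 1 ≤ r ≤ u such that v·r ≡ 1 (mod u), and let n = 6k+3 for some integer k ≥ 0. Set t_n = u·F_{n−2} + v·F_{n−1} and t_{n+1} = u·F_{n−1} + v·F_n. Then x = (1/2)(r·F_{n−1} + ((v·r−1)/u)·F_n − 1) and y = (1/2)((u−r)·F_{n−2} + (((u−r)·v+1)/u)·F_{n−1} − 1) are nonnegative integers (in particular u divides vr−1 and u divides (u−r)v+1, and the displayed halves are integers), and 1 + t_n·x + t_{n+1}·y = (t_n−1)(t_{n+1}−1)/2.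 -/
theorem F_pos {m : ℕ} (hm : 0 < m) : 0 < F m := by
  simpa [F] using hm

theorem F_add_six (m : ℕ) : F (m + 6) = 5 * F m + 8 * F (m + 1) := by
  have h0 := F_add_two m
  have h1 := F_add_two (m + 1)
  have h2 := F_add_two (m + 2)
  have h3 := F_add_two (m + 3)
  have h4 := F_add_two (m + 4)
  grind

/-- The consecutive Fibonacci numbers with indices `6k + 1` and `6k + 2` are odd, and they satisfy
Cassini's identity. -/
theorem odd_F_and_cassini (k : ℕ) :
    Odd (F (6 * k + 1)) ∧ Odd (F (6 * k + 2)) ∧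
      F (6 * k + 1) * (F (6 * k + 1) + F (6 * k + 2)) - F (6 * k + 2) ^ 2 = 1 := by
  induction k with
  | zero => simp [F]
  | succ k ih =>
    obtain ⟨ha, hb, hc⟩ := ih
    have h₁ : F (6 * (k + 1) + 1) = 5 * F (6 * k + 1) + 8 * F (6 * k + 2) :=
      F_add_six (6 * k + 1)
    have h₂ : F (6 * (k + 1) + 2) = 8 * F (6 * k + 1) + 13 * F (6 * k + 2) := by
      have h := F_add_six (6 * k + 2)
      have h' : F (6 * k + 2 + 1) = _ := F_add_two (6 * k + 1)
      rw [show 6 * (k + 1) + 2 = 6 * k + 2 + 6 by ring, h, h']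
      ring
    rw [h₁, h₂]
    refine ⟨by grind, by grind, ?_⟩
    linear_combination hc

theorem stmt_15 (u v : ℕ) (hu : 0 < u) (hv : 0 < v) (hcop : Nat.Coprime u v)
    (huodd : Odd u) (r : ℤ) (hrodd : Odd r) (hr1 : 1 ≤ r) (hru : r ≤ (u : ℤ))
    (hmod : (v : ℤ) * r ≡ 1 [ZMOD (u : ℤ)])
    (n k : ℕ) (hn : n = 6*k + 3) :
    (u : ℤ) ∣ ((v : ℤ) * r - 1) ∧
    (u : ℤ) ∣ (((u : ℤ) - r) * v + 1) ∧
    2 ∣ (r * F (n-1) + (((v : ℤ) * r - 1) / u) * F n - 1) ∧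
    2 ∣ (((u : ℤ) - r) * F (n-2) + ((((u : ℤ) - r) * v + 1) / u) * F (n-1) - 1) ∧
    0 ≤ (r * F (n-1) + (((v : ℤ) * r - 1) / u) * F n - 1) / 2 ∧
    0 ≤ (((u : ℤ) - r) * F (n-2) + ((((u : ℤ) - r) * v + 1) / u) * F (n-1) - 1) / 2 ∧
    1 + ((u : ℤ) * F (n-2) + v * F (n-1)) *
        ((r * F (n-1) + (((v : ℤ) * r - 1) / u) * F n - 1) / 2)
      + ((u : ℤ) * F (n-1) + v * F n) *
        ((((u : ℤ) - r) * F (n-2) + ((((u : ℤ) - r) * v + 1) / u) * F (n-1) - 1) / 2)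
      = (((u : ℤ) * F (n-2) + v * F (n-1)) - 1) * (((u : ℤ) * F (n-1) + v * F n) - 1) / 2 := by
  obtain ⟨w, hw⟩ : (u : ℤ) ∣ (v : ℤ) * r - 1 := hmod.symm.dvd
  have hw' : ((u : ℤ) - r) * v + 1 = u * (v - w) := by linear_combination -hw
  have hu0 : (0 : ℤ) < u := by exact_mod_cast hu
  have hv0 : (0 : ℤ) < v := by exact_mod_cast hv
  have hu_odd : Odd (u : ℤ) := by exact_mod_cast huodd
  have hw_nonneg : 0 ≤ w := by
    refine nonneg_of_mul_nonneg_right (a := (u : ℤ)) ?_ hu0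
    nlinarith
  have hvw_pos : 0 < (v : ℤ) - w := by
    refine pos_of_mul_pos_right (a := (u : ℤ)) ?_ hu0.le
    nlinarith
  have hvw_odd : Odd ((v : ℤ) - w) := by
    have h : Odd ((u : ℤ) * (v - w)) := by
      rw [← hw']
      exact ((hu_odd.sub_odd hrodd).mul_right _).add_one
    exact (Int.odd_mul.mp h).2
  obtain ⟨ha_odd, hb_odd, hcassini⟩ := odd_F_and_cassini k
  have ha_pos : 0 < F (6 * k + 1) := F_pos (by omega)
  have hb_pos : 0 < F (6 * k + 2) := F_pos (by omega)
  have hFn : F n = F (6 * k + 1) + F (6 * k + 2) := hn ▸ F_add_two (6 * k + 1)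
  rw [hFn, show n - 1 = 6 * k + 2 by omega, show n - 2 = 6 * k + 1 by omega, hw, hw',
    Int.mul_ediv_cancel_left _ hu0.ne', Int.mul_ediv_cancel_left _ hu0.ne']
  generalize F (6 * k + 1) = a at *
  generalize F (6 * k + 2) = b at *
  obtain ⟨x, hx⟩ : 2 ∣ r * b + w * (a + b) - 1 :=
    (((hrodd.mul hb_odd).add_even ((ha_odd.add_odd hb_odd).mul_left w)).sub_odd odd_one).two_dvd
  obtain ⟨y, hy⟩ : 2 ∣ ((u : ℤ) - r) * a + (v - w) * b - 1 :=
    (((((hu_odd.sub_odd hrodd).mul_right a)).add_odd (hvw_odd.mul hb_odd)).sub_odd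
      odd_one).two_dvd
  have hx_nonneg : 0 ≤ 2 * x := by
    rw [← hx]
    nlinarith [mul_pos (show 0 < r by omega) hb_pos, mul_nonneg hw_nonneg (add_pos ha_pos hb_pos).le]
  have hy_nonneg : 0 ≤ 2 * y := by
    rw [← hy]
    nlinarith [mul_nonneg (sub_nonneg.mpr hru) ha_pos.le, mul_pos hvw_pos hb_pos]
  rw [hx, hy, Int.mul_ediv_cancel_left _ two_ne_zero, Int.mul_ediv_cancel_left _ two_ne_zero]
  refine ⟨dvd_mul_right _ _, dvd_mul_right _ _, dvd_mul_right _ _, dvd_mul_right _ _,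
    by omega, by omega, ?_⟩
  symm
  apply Int.ediv_eq_of_eq_mul_right two_ne_zero
  linear_combination (u * a + v * b) * hx + (u * b + v * (a + b)) * hy +
    hcassini + (a * (a + b) - b ^ 2) * hw
end

section
/- Let A and B be coprime positive integers, each at least 2. (a) If A is odd, then the equation A·x + B·y = (A−1)(B−1)/2 has a solution in nonnegative integers if and only if the unique integer t with 0 < t < A and B·t ≡ 1 (mod A) is odd. (b) If A is even (so B is odd), then the equation A·x + B·y = (A−1)(B−1)/2 has a solution in nonnegative integers if and only if the unique integer s with 0 < s < B and A·s ≡ 1 (mod B) is odd. -/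
theorem exists_add_eq_half_iff_odd_inverse {A B : ℕ} (hA : 2 ≤ A) (hB : 2 ≤ B)
    (hcop : Nat.Coprime A B) (hodd : Odd A) :
    (∃ x y : ℕ, A * x + B * y = (A - 1) * (B - 1) / 2) ↔
      ∃ t : ℕ, 0 < t ∧ t < A ∧ B * t ≡ 1 [MOD A] ∧ Odd t := by
  obtain ⟨k, rfl⟩ := hodd
  obtain ⟨b, rfl⟩ : ∃ b, B = b + 1 := ⟨B - 1, by omega⟩
  have hhalf : (2 * k + 1 - 1) * (b + 1 - 1) / 2 = k * b := by
    rw [Nat.add_sub_cancel, Nat.add_sub_cancel, mul_assoc, Nat.mul_div_cancel_left _ two_pos]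
  rw [hhalf]
  constructor
  · rintro ⟨x, y, hxy⟩
    obtain ⟨t, htA, ht⟩ := Nat.exists_mul_mod_eq_one_of_coprime hcop.symm (by omega)
    have hmod : (b + 1) * t ≡ 1 [MOD 2 * k + 1] := by
      rw [Nat.ModEq, ht, Nat.mod_eq_of_lt (by omega)]
    have ht0 : 0 < t := by
      rcases Nat.eq_zero_or_pos t with rfl | h
      · simp at ht
      · exact h
    refine ⟨t, ht0, htA, hmod, y, ?_⟩
    have hyk : y < k := by
      by_contra! h
      nlinarith [Nat.mul_le_mul_left (b + 1) h, Nat.zero_le ((2 * k + 1) * x)]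
    obtain ⟨m, hm⟩ := (Nat.modEq_iff_dvd.mp hmod.symm)
    have hdvd : ((2 * k + 1 : ℕ) : ℤ) ∣ ((b + 1 : ℕ) : ℤ) * ((t : ℤ) - 1 - 2 * y) := by
      refine ⟨2 * x + 1 + m - (b + 1), ?_⟩
      zify at hxy
      push_cast at hm ⊢
      linear_combination hm - 2 * hxy
    have hdvd' := (Nat.isCoprime_iff_coprime.mpr hcop).dvd_of_dvd_mul_left hdvd
    have hzero := Int.eq_zero_of_abs_lt_dvd hdvd' (by rw [abs_lt]; omega)
    omega
  · rintro ⟨t, -, htA, hmod, j, rfl⟩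
    obtain ⟨m, hm⟩ := (Nat.modEq_iff_dvd' (by nlinarith)).mp hmod.symm
    have hm' : (b + 1) * (2 * j + 1) = (2 * k + 1) * m + 1 := by
      have : 1 ≤ (b + 1) * (2 * j + 1) := Nat.mul_pos (by omega) (by omega)
      omega
    have hmb : m ≤ b := by
      by_contra! h
      nlinarith [Nat.mul_le_mul_left (2 * k + 1) h, Nat.mul_lt_mul_of_pos_left htA b.succ_pos]
    have heven : b = m + 2 * ((b - m) / 2) := by
      have h : b + 2 * (b * j + j) = m + 2 * (k * m) := by linarith
      omega
    refine ⟨(b - m) / 2, j, ?_⟩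
    generalize (b - m) / 2 = x at heven
    nlinarith

theorem stmt_16 (A B : ℕ) (hA : 2 ≤ A) (hB : 2 ≤ B) (hcop : Nat.Coprime A B) :
    (Odd A →
      ((∃ x y : ℕ, A * x + B * y = (A - 1) * (B - 1) / 2) ↔
        ∃ t : ℕ, 0 < t ∧ t < A ∧ B * t ≡ 1 [MOD A] ∧ Odd t)) ∧
    (Even A →
      ((∃ x y : ℕ, A * x + B * y = (A - 1) * (B - 1) / 2) ↔
        ∃ s : ℕ, 0 < s ∧ s < B ∧ A * s ≡ 1 [MOD B] ∧ Odd s)) := by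
  refine ⟨exists_add_eq_half_iff_odd_inverse hA hB hcop, fun hev => ?_⟩
  have hodd : Odd B := by
    rw [← Nat.not_even_iff_odd]
    intro hB'
    exact Nat.not_coprime_of_dvd_of_dvd one_lt_two hev.two_dvd hB'.two_dvd hcop
  rw [← exists_add_eq_half_iff_odd_inverse hB hA hcop.symm hodd, exists_comm]
  simp only [add_comm, mul_comm (B - 1)]
end

section
/- Fix an integer k ≥ 1. For positive integers m, n, say Γ(m,n) = 0 if, writing d = gcd(m,n), the equation (m/d)·x + (n/d)·y = ((m/d)−1)((n/d)−1)/2 has a solution in nonnegative integers x, y (and Γ(m,n) = 1 otherwise). Then there exists an integer N such that for every n ≥ N, Γ(n^k, (n+1)^k) ≠ Γ((n+1)^k, (n+2)^k); that is, the sequence (Γ(n^k, (n+1)^k))_{n≥1} is eventually alternating 0,1,0,1,…. -/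
/-- `GammaZero m n` says that for `d = gcd(m,n)` the equation
`(m/d)·x + (n/d)·y = ((m/d)−1)((n/d)−1)/2` has a nonnegative integer solution,
i.e. that `Γ(m,n) = 0`. -/
def GammaZero (m n : ℕ) : Prop :=
  ∃ x y : ℕ, (m / Nat.gcd m n) * x + (n / Nat.gcd m n) * y
    = (m / Nat.gcd m n - 1) * (n / Nat.gcd m n - 1) / 2

theorem GammaZero.comm (m n : ℕ) : GammaZero m n ↔ GammaZero n m := by
  unfold GammaZero
  rw [Nat.gcd_comm n m, mul_comm (n / _ - 1), exists_comm]
  simp only [add_comm]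

theorem gammaZero_iff_of_coprime {w M : ℕ} (hw : 0 < w) (hM : Odd M) (h : Nat.Coprime w M) :
    GammaZero w M ↔
      ∃ x y : ℕ, (w : ℤ) * (2 * x + 1) + M * (2 * y + 1) = w * M + 1 := by
  unfold GammaZero
  rw [h.gcd_eq_one, Nat.div_one, Nat.div_one]
  obtain ⟨c, rfl⟩ := hM
  obtain ⟨v, rfl⟩ : ∃ v, w = v + 1 := ⟨w - 1, by omega⟩
  refine exists_congr fun x => exists_congr fun y => ?_
  have : (v + 1 - 1) * (2 * c + 1 - 1) / 2 = v * c := by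
    rw [Nat.add_sub_cancel, Nat.add_sub_cancel, mul_left_comm]
    exact Nat.mul_div_cancel_left _ two_pos
  rw [this]
  zify
  constructor <;> intro h <;> linarith

/-- The parity and sign of an inverse `r` of `w` modulo `M` with `|r| < M` determine `Γ(w, M)`. -/
theorem gammaZero_iff_odd_iff_pos {w M : ℕ} {r : ℤ} (hw : 0 < w) (hwe : Even w) (hM : Odd M)
    (hr : (M : ℤ) ∣ w * r - 1) (hr0 : r ≠ 0) (hrM : |r| < M) :
    GammaZero w M ↔ (Odd r ↔ 0 < r) := by
  have hcop : IsCoprime (w : ℤ) M := by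
    obtain ⟨c, hc⟩ := hr
    exact ⟨r, -c, by linarith⟩
  have hwE : Even (w : ℤ) := by exact_mod_cast hwe
  have hwZ : (0 : ℤ) < w := by exact_mod_cast hw
  obtain ⟨s, hs, hs0, hsM, hsodd⟩ : ∃ s : ℤ, (M : ℤ) ∣ w * s - 1 ∧ 0 < s ∧ s < M ∧
      ((Odd r ↔ 0 < r) ↔ Odd s) := by
    rw [abs_lt] at hrM
    rcases lt_or_gt_of_ne hr0 with h | h
    · refine ⟨r + M, ?_, by linarith, by linarith, ?_⟩
      · exact (dvd_add hr (dvd_mul_left (M : ℤ) w)).trans (dvd_of_eq (by ring))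
      · simp [h.not_gt, Int.odd_add, Nat.not_even_iff_odd.mpr hM]
    · exact ⟨r, hr, h, hrM.2, by simp [h]⟩
  rw [hsodd, gammaZero_iff_of_coprime hw hM (Nat.isCoprime_iff_coprime.mp hcop)]
  have hMZ : (0 : ℤ) < M := hs0.trans hsM
  constructor
  · rintro ⟨x, y, hxy⟩
    have hdvd : (M : ℤ) ∣ w * ((2 * x + 1) - s) := by
      have h1 : (M : ℤ) ∣ w * (2 * x + 1) - 1 := ⟨w - (2 * y + 1), by linarith⟩
      exact (dvd_sub h1 hs).trans (dvd_of_eq (by ring))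
    have hdvd' := hcop.symm.dvd_of_dvd_mul_left hdvd
    have hlt : (2 * x + 1 : ℤ) < M + 1 := by
      by_contra hcon
      have : (w : ℤ) * (M + 1) ≤ w * (2 * x + 1) := by
        apply mul_le_mul_of_nonneg_left _ hwZ.le
        linarith
      nlinarith [mul_nonneg hMZ.le (Int.natCast_nonneg y)]
    have := Int.eq_zero_of_abs_lt_dvd hdvd' (by rw [abs_lt]; constructor <;> omega)
    exact ⟨x, by linarith⟩
  · rintro ⟨x, hx⟩
    obtain ⟨c, hc⟩ := hs
    have hodd : Odd (M * (w - c)) := by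
      have : (M : ℤ) * (w - c) = w * (M - s) + 1 := by linarith
      rw [this]
      exact (hwE.mul_right _).add_one
    obtain ⟨y, hy⟩ := (Int.odd_mul.mp hodd).2
    have hpos : 0 < (w : ℤ) - c := by
      have : 0 < (M : ℤ) * (w - c) := by nlinarith
      exact pos_of_mul_pos_right this hMZ.le
    lift x to ℕ using by omega
    lift y to ℕ using by omega
    refine ⟨x, y, ?_⟩
    rw [← hy, ← hx]
    linarith

theorem abs_sum_mul_pow_lt (f : ℕ → ℕ) (d : ℕ) (t : ℤ)
    (ht : (∑ j ∈ Finset.range d, f j : ℕ) < |t|) :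
    |∑ j ∈ Finset.range d, (f j : ℤ) * t ^ j| < |t| ^ d := by
  have htpos : 0 < |t| := lt_of_le_of_lt (Int.natCast_nonneg _) ht
  refine lt_of_mul_lt_mul_left ?_ htpos.le
  calc |t| * |∑ j ∈ Finset.range d, (f j : ℤ) * t ^ j|
      ≤ |t| * ∑ j ∈ Finset.range d, (f j : ℤ) * |t| ^ j := by
        gcongr
        refine (Finset.abs_sum_le_sum_abs _ _).trans_eq ?_
        simp [abs_mul, abs_pow]
    _ = ∑ j ∈ Finset.range d, (f j : ℤ) * |t| ^ (j + 1) := by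
        rw [Finset.mul_sum]
        exact Finset.sum_congr rfl fun j _ => by ring
    _ ≤ ∑ j ∈ Finset.range d, (f j : ℤ) * |t| ^ d := by
        gcongr with j hj
        exact Finset.mem_range.mp hj
    _ = (∑ j ∈ Finset.range d, f j : ℕ) * |t| ^ d := by
        rw [← Finset.sum_mul, Nat.cast_sum]
    _ < |t| * |t| ^ d := by gcongr

/-- The truncation at degree `d` of the power series of `(1 - t)⁻¹ ^ (d + 1)`, evaluated at `t`. -/
def truncInvPow (d : ℕ) (t : ℤ) : ℤ :=
  ∑ j ∈ Finset.range (d + 1), ((d + j).choose d : ℤ) * t ^ j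

open Polynomial in
theorem pow_dvd_one_sub_pow_mul_truncInvPow (d : ℕ) (t : ℤ) :
    t ^ (d + 1) ∣ (1 - t) ^ (d + 1) * truncInvPow d t - 1 := by
  set S : PowerSeries ℤ := PowerSeries.mk fun j => ((d + j).choose d : ℤ)
  have hS : (1 - PowerSeries.X) ^ (d + 1) * S = 1 := by
    rw [mul_comm]
    exact PowerSeries.mk_add_choose_mul_one_sub_pow_eq_one ℤ d
  have hdvd : (X : ℤ[X]) ^ (d + 1) ∣ (1 - X) ^ (d + 1) * PowerSeries.trunc (d + 1) S - 1 := by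
    rw [X_pow_dvd_iff]
    intro i hi
    have h1 : PowerSeries.coeff i ((1 - PowerSeries.X) ^ (d + 1) *
        (PowerSeries.trunc (d + 1) S : PowerSeries ℤ)) = PowerSeries.coeff i ((1 - PowerSeries.X) ^ (d + 1) * S) := by
      rw [PowerSeries.coeff_mul, PowerSeries.coeff_mul]
      refine Finset.sum_congr rfl fun p hp => ?_
      have : p.2 < d + 1 := by
        have := Finset.HasAntidiagonal.mem_antidiagonal.mp hp
        omega
      rw [Polynomial.coeff_coe, PowerSeries.coeff_trunc, if_pos this]
    rw [← Polynomial.coeff_coe]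
    push_cast
    rw [map_sub, h1, hS, sub_self]
  have := _root_.map_dvd (evalRingHom t) hdvd
  have hev : (PowerSeries.trunc (d + 1) S).eval t = truncInvPow d t := by
    rw [eval, PowerSeries.eval₂_trunc_eq_sum_range]
    simp [truncInvPow, S]
  simpa [hev] using this

theorem abs_truncInvPow_lt {d : ℕ} {t : ℤ} (ht : truncInvPow d 1 < |t|) :
    |truncInvPow d t| < |t| ^ (d + 1) :=
  abs_sum_mul_pow_lt (fun j => (d + j).choose d) (d + 1) t (by simpa [truncInvPow] using ht)

theorem truncInvPow_mul_pow_pos {d : ℕ} {t : ℤ} (ht : truncInvPow d 1 < |t|) :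
    0 < truncInvPow d t * t ^ d := by
  have hsplit (s : ℤ) : truncInvPow d s =
      ∑ j ∈ Finset.range d, ((d + j).choose d : ℤ) * s ^ j + ((d + d).choose d : ℤ) * s ^ d :=
    Finset.sum_range_succ _ _
  have hc : (1 : ℤ) ≤ (d + d).choose d := by exact_mod_cast Nat.choose_pos (by omega)
  have hA := abs_sum_mul_pow_lt (fun j => (d + j).choose d) d t (by
    have := hsplit 1
    simp only [one_pow, mul_one] at this
    push_cast
    linarith)
  rw [hsplit]
  set A := ∑ j ∈ Finset.range d, ((d + j).choose d : ℤ) * t ^ j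
  rw [← abs_pow] at hA
  have h1 : -(|A| * |t ^ d|) ≤ A * t ^ d := by
    rw [← abs_mul]; exact neg_abs_le _
  have h2 : |t ^ d| * |t ^ d| = t ^ d * t ^ d := abs_mul_abs_self _
  have h3 : 0 < |t ^ d| := (abs_nonneg A).trans_lt hA
  nlinarith [mul_lt_mul_of_pos_right hA h3, mul_nonneg (sub_nonneg.mpr hc) (mul_pos h3 h3).le]

theorem odd_truncInvPow_iff {d : ℕ} {t : ℤ} (ht : Odd t) :
    Odd (truncInvPow d t) ↔ Odd (truncInvPow d 1) := by
  have : Even (truncInvPow d t - truncInvPow d 1) := by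
    unfold truncInvPow
    rw [← Finset.sum_sub_distrib]
    refine Finset.even_sum _ fun j _ => ?_
    rw [← mul_sub]
    exact ((ht.pow).sub_odd (odd_one.pow)).mul_left _
  rw [Int.even_sub'] at this
  exact this

theorem gammaZero_odd_succ_iff {d m : ℕ} (hm : Odd m) (hdm : truncInvPow d 1 < m) :
    GammaZero (m ^ (d + 1)) ((m + 1) ^ (d + 1)) ↔ (Odd (truncInvPow d 1) ↔ Even d) := by
  have hmZ : Odd (-(m : ℤ)) := by simpa using hm
  have ht : truncInvPow d 1 < |-(m : ℤ)| := by simpa using hdm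
  have hpos := truncInvPow_mul_pow_pos ht
  rw [GammaZero.comm, gammaZero_iff_odd_iff_pos (r := truncInvPow d (-m)) (by positivity)
    (hm.add_one.pow_of_ne_zero d.add_one_ne_zero) hm.pow, odd_truncInvPow_iff hmZ]
  · rcases d.even_or_odd with h | h
    · rw [h.neg_pow] at hpos
      simp [h, pos_of_mul_pos_left hpos (by positivity)]
    · rw [h.neg_pow, mul_neg, ← neg_mul] at hpos
      have := pos_of_mul_pos_left hpos (by positivity)
      simp [Nat.not_even_iff_odd.mpr h, (neg_pos.mp this).not_gt]
  · have := pow_dvd_one_sub_pow_mul_truncInvPow d (-m)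
    rw [sub_neg_eq_add, add_comm (1 : ℤ), neg_pow, (isUnit_one.neg.pow _).mul_left_dvd] at this
    exact_mod_cast this
  · exact left_ne_zero_of_mul hpos.ne'
  · simpa using abs_truncInvPow_lt ht

theorem gammaZero_even_succ_iff {d n : ℕ} (hn : Even n) (hn0 : 0 < n)
    (hdn : truncInvPow d 1 < n + 1) :
    GammaZero (n ^ (d + 1)) ((n + 1) ^ (d + 1)) ↔ ¬ (Odd (truncInvPow d 1) ↔ Even d) := by
  have hodd : Odd ((n : ℤ) + 1) := by exact_mod_cast hn.add_one
  have ht : truncInvPow d 1 < |(n : ℤ) + 1| := hdn.trans_le (le_abs_self _)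
  have hpos := pos_of_mul_pos_left (truncInvPow_mul_pow_pos ht) (by positivity)
  have hsign : Odd ((-1) ^ (d + 1) * truncInvPow d (n + 1)) ↔ Odd (truncInvPow d (n + 1)) := by
    simp [Int.odd_mul, Odd.pow]
  rw [gammaZero_iff_odd_iff_pos (r := (-1) ^ (d + 1) * truncInvPow d (n + 1)) (by positivity)
    (hn.pow_of_ne_zero d.add_one_ne_zero) hn.add_one.pow, hsign, odd_truncInvPow_iff hodd]
  · rcases d.even_or_odd with h | h
    · simp [h, h.add_one.neg_one_pow, hpos.not_gt]
    · simp [Nat.not_even_iff_odd.mpr h, h.add_one.neg_one_pow, hpos]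
  · have := pow_dvd_one_sub_pow_mul_truncInvPow d (n + 1)
    rw [show (1 : ℤ) - (n + 1) = -n by ring, neg_pow] at this
    push_cast
    exact this.trans (dvd_of_eq (by ring))
  · exact mul_ne_zero (by simp) hpos.ne'
  · have := abs_truncInvPow_lt ht
    rw [abs_of_pos (show (0 : ℤ) < n + 1 by positivity)] at this
    rw [abs_mul, abs_pow, abs_neg, abs_one, one_pow, one_mul]
    exact_mod_cast this

theorem stmt_17 (k : ℕ) (hk : 1 ≤ k) :
    ∃ N : ℕ, ∀ n : ℕ, N ≤ n →
      (GammaZero (n ^ k) ((n+1) ^ k) ↔ ¬ GammaZero ((n+1) ^ k) ((n+2) ^ k)) := by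
  obtain ⟨d, rfl⟩ : ∃ d, k = d + 1 := ⟨k - 1, by omega⟩
  refine ⟨(truncInvPow d 1).toNat + 1, fun n hn => ?_⟩
  rcases n.even_or_odd with h | h
  · rw [gammaZero_even_succ_iff h (by omega) (by omega),
      gammaZero_odd_succ_iff h.add_one (by omega)]
  · rw [gammaZero_odd_succ_iff h (by omega),
      gammaZero_even_succ_iff h.add_one (by omega) (by omega), not_not]
end

section
/- Let a and r be positive integers and define the arithmetic progression a_n = a + (n−1)·r for n ≥ 1, and let d = gcd(a, r). Then for every n ≥ 1 one has gcd(a_n, a_{n+1}) = d, and the equation (a_n/d)·x + (a_{n+1}/d)·y = ((a_n/d)−1)((a_{n+1}/d)−1)/2 has a solution in nonnegative integers x, y if and only if the equation (a_{n+1}/d)·x + (a_{n+2}/d)·y = ((a_{n+1}/d)−1)((a_{n+2}/d)−1)/2 has no solution in nonnegative integers; that is, the sequence (Γ(a_n, a_{n+1}))_{n≥1} is alternating, equal to 0,1,0,1,… or 1,0,1,0,…. -/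
/-- Two coprime numbers `p` and `q > 1` admit positive `u < q` and `v ≤ p` with
`p * u + q * v = p * q + 1`. -/
theorem exists_mul_add_mul_eq_mul_add_one {p q : ℕ} (hp : 0 < p) (hq : 1 < q)
    (h : Nat.Coprime p q) :
    ∃ u v : ℕ, 0 < u ∧ u < q ∧ 0 < v ∧ v ≤ p ∧ p * u + q * v = p * q + 1 := by
  obtain ⟨u, hu, hmod⟩ := Nat.exists_mul_mod_eq_one_of_coprime h hq
  have hdiv := Nat.div_add_mod (p * u) q
  rw [hmod] at hdiv
  set k := p * u / q
  have hk : k < p := by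
    have : p * u < p * q := Nat.mul_lt_mul_of_pos_left hu hp
    nlinarith
  have hu0 : 0 < u := by
    rcases Nat.eq_zero_or_pos u with rfl | h0
    · simp at hdiv
    · exact h0
  refine ⟨u, p - k, hu0, hu, Nat.sub_pos_of_lt hk, Nat.sub_le p k, ?_⟩
  zify [hk.le] at hdiv ⊢
  linear_combination -hdiv

/-- Solvability of `p * x + q * y = (p - 1) * (q - 1) / 2` is read off from the parities of the
reduced solution of `p * u + q * v = p * q + 1`. -/
theorem exists_mul_add_mul_eq_half_iff {p q u v : ℕ} (hp : 0 < p) (hq : 0 < q)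
    (h : Nat.Coprime p q) (hu : 0 < u) (huq : u ≤ q) (huv : p * u + q * v = p * q + 1) :
    (∃ x y : ℕ, p * x + q * y = (p - 1) * (q - 1) / 2) ↔ Odd u ∧ Odd v := by
  obtain ⟨s, rfl⟩ : ∃ s, p = s + 1 := ⟨p - 1, by omega⟩
  obtain ⟨t, rfl⟩ : ∃ t, q = t + 1 := ⟨q - 1, by omega⟩
  simp only [Nat.add_sub_cancel]
  have heven : 2 * (s * t / 2) = s * t := by
    apply Nat.mul_div_cancel'
    rw [← even_iff_two_dvd]
    by_contra hne
    rw [Nat.even_mul, not_or, Nat.not_even_iff_odd, Nat.not_even_iff_odd] at hne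
    have := Nat.dvd_gcd hne.1.add_one.two_dvd hne.2.add_one.two_dvd
    rw [h.gcd_eq_one] at this
    omega
  constructor
  · rintro ⟨x, y, hxy⟩
    have key : (s + 1) * (2 * x + 1) + (t + 1) * (2 * y + 1) = (s + 1) * (t + 1) + 1 := by
      linear_combination 2 * hxy + heven
    have hx : 2 * x + 1 ≤ t + 1 := by nlinarith
    have hmod : (s + 1) * (2 * x + 1) ≡ (s + 1) * u [MOD t + 1] := by
      apply Nat.ModEq.add_right_cancel' ((t + 1) * (2 * y + 1 + v))
      have h₁ : (s + 1) * (2 * x + 1) + (t + 1) * (2 * y + 1 + v)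
          = (s + 1) * (t + 1) + 1 + (t + 1) * v := by linear_combination key
      have h₂ : (s + 1) * u + (t + 1) * (2 * y + 1 + v)
          = (s + 1) * (t + 1) + 1 + (t + 1) * (2 * y + 1) := by linear_combination huv
      rw [h₁, h₂]
      simp [Nat.ModEq]
    have hmod' := Nat.ModEq.cancel_left_of_coprime (by simpa using h.symm) hmod
    have hxu : 2 * x + 1 = u := by
      obtain ⟨c, hc⟩ := (Nat.modEq_iff_dvd.mp hmod')
      have hc0 : c = 0 := by
        push_cast at hc
        have h₁ : c < 1 := by nlinarith
        have h₂ : -1 < c := by nlinarith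
        omega
      subst hc0
      push_cast at hc
      omega
    subst hxu
    have hyv : 2 * y + 1 = v := by
      apply Nat.eq_of_mul_eq_mul_left hq
      omega
    exact ⟨odd_two_mul_add_one x, hyv ▸ odd_two_mul_add_one y⟩
  · rintro ⟨⟨x, rfl⟩, ⟨y, rfl⟩⟩
    refine ⟨x, y, ?_⟩
    have : 2 * ((s + 1) * x + (t + 1) * y) = 2 * (s * t / 2) := by
      rw [heven]
      linear_combination huv
    omega

/-- For three consecutive terms `p, p + r, p + 2 * r` of a progression with `p` and `r` coprime,
exactly one of the two equations attached to neighbouring terms is solvable. -/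
theorem exists_eq_half_iff_not_exists_eq_half {p r : ℕ} (hp : 0 < p) (hr : 0 < r)
    (h : Nat.Coprime p r) :
    (∃ x y : ℕ, p * x + (p + r) * y = (p - 1) * (p + r - 1) / 2) ↔
      ¬ ∃ x y : ℕ, (p + r) * x + (p + 2 * r) * y = (p + r - 1) * (p + 2 * r - 1) / 2 := by
  have hpq : Nat.Coprime p (p + r) := by simpa using h
  have hqs : Nat.Coprime (p + r) (p + 2 * r) := by
    have : p + 2 * r = p + r + r := by ring
    rw [this]
    simpa using h
  obtain ⟨u, v, hu, huq, hv, hvp, huv⟩ :=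
    exists_mul_add_mul_eq_mul_add_one hp (by omega) hpq
  obtain ⟨w, hw⟩ : ∃ w, u + w = p + r := ⟨p + r - u, by omega⟩
  have hlt : p < v + 2 * u := by
    by_contra! hle
    nlinarith
  obtain ⟨z, hz⟩ : ∃ z, p + z = v + 2 * u := ⟨v + 2 * u - p, by omega⟩
  have hzw : (p + r) * z + (p + 2 * r) * w = (p + r) * (p + 2 * r) + 1 := by
    zify at *
    linear_combination huv + (p + r : ℤ) * hz + (p + 2 * r : ℤ) * hw
  have hzs : z ≤ p + 2 * r := by nlinarith
  rw [exists_mul_add_mul_eq_half_iff hp (by omega) hpq hu huq.le huv,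
    exists_mul_add_mul_eq_half_iff (by omega) (by omega) hqs (by omega) hzs hzw]
  have hpar := congrArg Even huv
  have hparw := congrArg Even hw
  have hparz := congrArg Even hz
  simp only [Nat.even_add, Nat.even_mul, Nat.not_even_one, even_two] at hpar hparw hparz
  simp only [← Nat.not_even_iff_odd]
  grind

theorem stmt_18 (a r : ℕ) (ha : 0 < a) (hr : 0 < r) :
    ∀ n : ℕ, 1 ≤ n →
      Nat.gcd (a + (n-1) * r) (a + n * r) = Nat.gcd a r ∧
      ((∃ x y : ℕ, (a + (n-1) * r) / Nat.gcd a r * x + (a + n * r) / Nat.gcd a r * y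
          = ((a + (n-1) * r) / Nat.gcd a r - 1) * ((a + n * r) / Nat.gcd a r - 1) / 2) ↔
       ¬ (∃ x y : ℕ, (a + n * r) / Nat.gcd a r * x + (a + (n+1) * r) / Nat.gcd a r * y
          = ((a + n * r) / Nat.gcd a r - 1) * ((a + (n+1) * r) / Nat.gcd a r - 1) / 2)) := by
  intro n hn
  obtain ⟨k, rfl⟩ : ∃ k, n = k + 1 := ⟨n - 1, by omega⟩
  rw [Nat.add_sub_cancel]
  constructor
  · have : a + (k + 1) * r = a + k * r + r := by ring
    rw [this]
    simp
  · obtain ⟨b, s, hbs, hb, hs⟩ := Nat.exists_coprime a r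
    have hd : 0 < Nat.gcd a r := Nat.gcd_pos_of_pos_left _ ha
    generalize Nat.gcd a r = d at *
    subst hb hs
    have hdiv (j : ℕ) : (b * d + j * (s * d)) / d = b + j * s := by
      rw [← mul_assoc, ← add_mul, Nat.mul_div_cancel _ hd]
    have h₁ : b + (k + 1) * s = b + k * s + s := by ring
    have h₂ : b + (k + 1 + 1) * s = b + k * s + 2 * s := by ring
    rw [hdiv, hdiv, hdiv, h₁, h₂]
    have hb := Nat.pos_of_mul_pos_right ha
    exact exists_eq_half_iff_not_exists_eq_half (by positivity) (Nat.pos_of_mul_pos_right hr)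
      (by simpa using hbs)
end

section
/- Let k be an odd positive integer. For a positive integer n, let P(n) denote the statement that, writing d = gcd(k,n), the equation (k/d)·x + (n/d)·y = ((k/d)−1)((n/d)−1)/2 has a solution in nonnegative integers x, y. Then: (i) for every n ≥ 1, P(n) holds if and only if P(n+k) holds; (ii) for every integer T with 1 ≤ T < k there exists n ≥ 1 such that P(n) and P(n+T) are not equivalent (so k is the exact period); and (iii) the number of n in {1, 2, …, k} for which P(n) holds equals one plus the number of n in {1, 2, …, k} for which P(n) fails. -/
/-- `P k n` says that, with `d = gcd(k,n)`, the equation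
`(k/d)·x + (n/d)·y = ((k/d)−1)((n/d)−1)/2` has a nonnegative integer solution. -/
def P (k n : ℕ) : Prop :=
  ∃ x y : ℕ, (k / Nat.gcd k n) * x + (n / Nat.gcd k n) * y
    = (k / Nat.gcd k n - 1) * (n / Nat.gcd k n - 1) / 2

/-- For odd `a`, solvability of `a x + b y = (a - 1)(b - 1) / 2` says that `b` has an odd inverse
modulo `a` in `[1, a]`. -/
theorem exists_eq_half_iff_exists_odd_inverse {a b : ℕ} (ha : Odd a) (hb : 0 < b) :
    (∃ x y : ℕ, a * x + b * y = (a - 1) * (b - 1) / 2) ↔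
      ∃ y : ℕ, 2 * y + 1 ≤ a ∧ (a : ℤ) ∣ b * (2 * y + 1) - 1 := by
  obtain ⟨h, rfl⟩ := ha
  obtain ⟨c, rfl⟩ : ∃ c, b = c + 1 := ⟨b - 1, by omega⟩
  have half : (2 * h + 1 - 1) * (c + 1 - 1) / 2 = h * c := by
    rw [Nat.add_sub_cancel, Nat.add_sub_cancel, mul_assoc, Nat.mul_div_cancel_left _ two_pos]
  rw [half]
  constructor
  · rintro ⟨x, y, e⟩
    refine ⟨y, ?_, (c : ℤ) - 2 * x, ?_⟩
    · have : y ≤ h := by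
        by_contra! hlt
        nlinarith [Nat.mul_le_mul_left c hlt.le, Nat.zero_le ((2 * h + 1) * x)]
      omega
    · zify at e
      push_cast
      linear_combination 2 * e
  · rintro ⟨y, hy, t, e⟩
    push_cast at e
    have ht : t ≤ c := by
      have hy' : (y : ℤ) ≤ h := by omega
      by_contra! hlt
      nlinarith
    obtain ⟨x, hx⟩ : (2 : ℤ) ∣ c - t := ⟨h * t - (c + 1) * y, by linear_combination e⟩
    lift x to ℕ using by omega
    refine ⟨x, y, ?_⟩
    zify
    have : (2 : ℤ) * ((2 * h + 1) * x + (c + 1) * y) = 2 * (h * c) := by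
      linear_combination e - (2 * h + 1) * hx
    linarith

theorem P_iff_exists_odd_inverse {k n : ℕ} (hodd : Odd k) (hn : 0 < n) :
    P k n ↔ ∃ y : ℕ, 2 * y + 1 ≤ k / k.gcd n ∧
      ((k / k.gcd n : ℕ) : ℤ) ∣ (n / k.gcd n : ℕ) * (2 * y + 1) - 1 :=
  exists_eq_half_iff_exists_odd_inverse
    (hodd.of_dvd_nat (Nat.div_dvd_of_dvd (Nat.gcd_dvd_left k n)))
    (Nat.div_pos (Nat.le_of_dvd hn (Nat.gcd_dvd_right k n)) (Nat.gcd_pos_of_pos_right k hn))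

theorem P_add_self_iff {k n : ℕ} (hodd : Odd k) (hn : 0 < n) : P k (n + k) ↔ P k n := by
  rw [P_iff_exists_odd_inverse hodd hn, P_iff_exists_odd_inverse hodd (by omega),
    Nat.gcd_add_self_right, Nat.add_div_of_dvd_left (Nat.gcd_dvd_left k n)]
  refine exists_congr fun y => and_congr_right fun _ => ?_
  rw [Nat.cast_add, add_mul, add_sub_right_comm, dvd_add_left (dvd_mul_right _ _)]

theorem P_self {k : ℕ} (hk : 0 < k) : P k k :=
  ⟨0, 0, by simp [Nat.div_self hk]⟩

/-- Negating `b` modulo an odd `a > 1` flips the parity of its inverse in `[1, a]`. -/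
theorem exists_odd_inverse_iff_not_of_dvd_add {a b c : ℕ} (ha : Odd a) (ha1 : a ≠ 1)
    (hab : a.Coprime b) (hbc : a ∣ b + c) :
    (∃ y : ℕ, 2 * y + 1 ≤ a ∧ (a : ℤ) ∣ b * (2 * y + 1) - 1) ↔
      ¬ ∃ y : ℕ, 2 * y + 1 ≤ a ∧ (a : ℤ) ∣ c * (2 * y + 1) - 1 := by
  have hbc' : (a : ℤ) ∣ b + c := by exact_mod_cast hbc
  have ha2 : 1 < a := by have := ha.pos; omega
  constructor
  · rintro ⟨y, hy, hby⟩ ⟨z, hz, hcz⟩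
    have key : (a : ℤ) ∣ b * (2 * y + 1 + (2 * z + 1)) := by
      have e : (b : ℤ) * (2 * y + 1 + (2 * z + 1)) =
          (2 * z + 1) * (b + c) + (b * (2 * y + 1) - 1) - (c * (2 * z + 1) - 1) := by ring
      rw [e]
      exact ((hbc'.mul_left _).add hby).sub hcz
    obtain ⟨q, hq⟩ : a ∣ 2 * y + 1 + (2 * z + 1) :=
      hab.dvd_of_dvd_mul_left (by exact_mod_cast key)
    obtain ⟨h, rfl⟩ := ha
    have hq2 : q ≤ 2 := by nlinarith
    interval_cases q
    · omega
    · omega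
    · have hyh : y = h := by omega
      subst hyh
      have h1 : ((2 * y + 1 : ℕ) : ℤ) ∣ 1 := by
        have : ((2 * y + 1 : ℕ) : ℤ) ∣ b * (2 * y + 1) := ⟨b, by push_cast; ring⟩
        exact (dvd_sub_right this).mp hby
      have h2 : 2 * y + 1 ∣ 1 := by exact_mod_cast h1
      exact ha1 (Nat.dvd_one.mp h2)
  · intro hnot
    obtain ⟨m, hma, hm⟩ := Nat.exists_mul_mod_eq_one_of_coprime hab.symm ha2
    have hbm : (a : ℤ) ∣ b * m - 1 := by
      have : (1 : ℕ) ≡ b * m [MOD a] := by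
        rw [Nat.ModEq, hm, Nat.mod_eq_of_lt ha2]
      exact_mod_cast (Nat.modEq_iff_dvd.mp this)
    rcases Nat.even_or_odd' m with ⟨y, rfl | rfl⟩
    · exfalso
      obtain ⟨h, rfl⟩ := ha
      refine hnot ⟨h - y, by omega, ?_⟩
      have hy : y ≤ h := by omega
      have e : (c : ℤ) * (2 * (h - y : ℕ) + 1) - 1 =
          (b + c) * (2 * h + 1 - 2 * y) + (b * (2 * y : ℕ) - 1) - (2 * h + 1 : ℕ) * b := by
        push_cast [hy]
        ring
      rw [e]
      exact ((hbc'.mul_right _).add hbm).sub (dvd_mul_right _ _)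
    · exact ⟨y, hma.le, by exact_mod_cast hbm⟩

theorem P_iff_not_P_of_dvd_add {k n m : ℕ} (hodd : Odd k) (hn : 0 < n) (hm : 0 < m)
    (hkn : ¬ k ∣ n) (hnm : k ∣ n + m) : P k n ↔ ¬ P k m := by
  have hd : 0 < k.gcd n := Nat.gcd_pos_of_pos_right k hn
  have hgcd : k.gcd m = k.gcd n := by
    apply Nat.dvd_antisymm
    · exact Nat.dvd_gcd (Nat.gcd_dvd_left _ _)
        ((Nat.dvd_add_left (Nat.gcd_dvd_right k m)).mp ((Nat.gcd_dvd_left k m).trans hnm))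
    · exact Nat.dvd_gcd (Nat.gcd_dvd_left _ _)
        ((Nat.dvd_add_right (Nat.gcd_dvd_right k n)).mp ((Nat.gcd_dvd_left k n).trans hnm))
  rw [P_iff_exists_odd_inverse hodd hn, P_iff_exists_odd_inverse hodd hm, hgcd]
  refine exists_odd_inverse_iff_not_of_dvd_add
    (hodd.of_dvd_nat (Nat.div_dvd_of_dvd (Nat.gcd_dvd_left k n))) (fun h => hkn ?_)
    (Nat.coprime_div_gcd_div_gcd hd) ?_
  · rw [← Nat.eq_of_dvd_of_div_eq_one (Nat.gcd_dvd_left k n) h]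
    exact Nat.gcd_dvd_right k n
  · rw [← Nat.add_div_of_dvd_right (Nat.gcd_dvd_right k n)]
    exact Nat.div_dvd_div (Nat.gcd_dvd_left k n) hnm

open scoped Classical in
theorem stmt_19 (k : ℕ) (hk : 0 < k) (hodd : Odd k) :
    (∀ n : ℕ, 1 ≤ n → (P k n ↔ P k (n + k))) ∧
    (∀ T : ℕ, 1 ≤ T → T < k → ∃ n : ℕ, 1 ≤ n ∧ ¬ (P k n ↔ P k (n + T))) ∧
    ((Finset.Icc 1 k).filter (fun n => P k n)).card
      = ((Finset.Icc 1 k).filter (fun n => ¬ P k n)).card + 1 := by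
  refine ⟨fun n hn => (P_add_self_iff hodd hn).symm, fun T hT hTk => ?_, ?_⟩
  · by_contra! hper
    have hmul : ∀ j : ℕ, P k T ↔ P k ((j + 1) * T) := by
      intro j
      induction j with
      | zero => simp
      | succ j ih =>
        rw [ih, add_mul (j + 1) 1 T, one_mul]
        exact hper _ (Nat.mul_pos j.succ_pos hT)
    obtain ⟨j, rfl⟩ : ∃ j, k = j + 2 := ⟨k - 2, by omega⟩
    have hneg : P (j + 2) T ↔ ¬ P (j + 2) ((j + 1) * T) :=
      P_iff_not_P_of_dvd_add hodd hT (Nat.mul_pos j.succ_pos hT)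
        (fun h => by have := Nat.le_of_dvd hT h; omega) ⟨T, by ring⟩
    have := hmul j
    tauto
  · have hself := P_self hk
    have hIcc : Finset.Icc 1 k = insert k (Finset.Ico 1 k) := (Finset.Ico_insert_right hk).symm
    rw [hIcc, Finset.filter_insert, Finset.filter_insert, if_pos hself,
      if_neg (not_not.mpr hself), Finset.card_insert_of_notMem (by simp), add_left_inj]
    have hflip : ∀ n, 1 ≤ n → n < k → (P k n ↔ ¬ P k (k - n)) := fun n hn hnk =>
      P_iff_not_P_of_dvd_add hodd hn (by omega)
        (fun h => by have := Nat.le_of_dvd hn h; omega) (by rw [Nat.add_sub_cancel' hnk.le])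
    refine Finset.card_nbij' (fun n => k - n) (fun n => k - n) ?_ ?_ ?_ ?_
    · intro n hn
      simp only [Finset.coe_filter, Finset.mem_Ico, Set.mem_ofPred_eq] at hn ⊢
      exact ⟨by omega, (hflip n hn.1.1 hn.1.2).mp hn.2⟩
    · intro n hn
      simp only [Finset.coe_filter, Finset.mem_Ico, Set.mem_ofPred_eq] at hn ⊢
      have := hflip n hn.1.1 hn.1.2
      exact ⟨by omega, by tauto⟩
    · intro n hn
      simp only [Finset.coe_filter, Finset.mem_Ico, Set.mem_ofPred_eq] at hn ⊢
      omega
    · intro n hn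
      simp only [Finset.coe_filter, Finset.mem_Ico, Set.mem_ofPred_eq] at hn ⊢
      omega
end
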